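/- arXiv:1807.08661 — 6 statements merged into one kernel-verified Lean document; each statement's English description precedes it below -/
import Mathlib

section
/- For every real number b > 1 there exists a real number a with 0 < a < 1 such that P₁(a,b)/Q₁(a,b) = P₂(a,b)/Q₂(a,b). (Solvability of the one-dimensional period problem for the SS-4 family of triply periodic minimal surfaces.) -/
open MeasureTheory Set

/-- P₁(a,b) = ∫_a^1 z^{-3/4}(z-a)^{1/2}(1-z)^{-3/4}(b-z)^{-1/4} dz -/
noncomputable def P1 (a b : ℝ) : ℝ :=
  ∫ z in Ioo a 1, z ^ (-(3:ℝ)/4) * (z - a) ^ ((1:ℝ)/2) * (1 - z) ^ (-(3:ℝ)/4) * (b - z) ^ (-(1:ℝ)/4)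

/-- Q₁(a,b) = ∫_0^a z^{-3/4}(a-z)^{1/2}(1-z)^{-3/4}(b-z)^{-1/4} dz -/
noncomputable def Q1 (a b : ℝ) : ℝ :=
  ∫ z in Ioo 0 a, z ^ (-(3:ℝ)/4) * (a - z) ^ ((1:ℝ)/2) * (1 - z) ^ (-(3:ℝ)/4) * (b - z) ^ (-(1:ℝ)/4)

/-- P₂(a,b) = ∫_a^1 z^{-1/4}(z-a)^{-1/2}(1-z)^{-1/4}(b-z)^{-3/4} dz -/
noncomputable def P2 (a b : ℝ) : ℝ :=
  ∫ z in Ioo a 1, z ^ (-(1:ℝ)/4) * (z - a) ^ (-(1:ℝ)/2) * (1 - z) ^ (-(1:ℝ)/4) * (b - z) ^ (-(3:ℝ)/4)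

/-- Q₂(a,b) = ∫_0^a z^{-1/4}(a-z)^{-1/2}(1-z)^{-1/4}(b-z)^{-3/4} dz -/
noncomputable def Q2 (a b : ℝ) : ℝ :=
  ∫ z in Ioo 0 a, z ^ (-(1:ℝ)/4) * (a - z) ^ (-(1:ℝ)/2) * (1 - z) ^ (-(1:ℝ)/4) * (b - z) ^ (-(3:ℝ)/4)

/-- The integral over `(0, 1)` obtained by rescaling a period integral of length `s`. -/
noncomputable def rescaledPeriod (p q : ℝ) (h : ℝ → ℝ) (s : ℝ) : ℝ :=
  ∫ t in Ioo (0:ℝ) 1, t ^ p * (1 - t) ^ q * (1 - s * t) ^ p * h (s * t)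

theorem integrableOn_rpow_mul_one_sub_rpow {p q : ℝ} (hp : -1 < p) (hq : -1 < q) :
    IntegrableOn (fun t : ℝ => t ^ p * (1 - t) ^ q) (Ioo 0 1) := by
  have h := (Complex.betaIntegral_convergent (u := ((p + 1 : ℝ) : ℂ)) (v := ((q + 1 : ℝ) : ℂ))
    (by rw [Complex.ofReal_re]; linarith) (by rw [Complex.ofReal_re]; linarith))
  rw [intervalIntegrable_iff_integrableOn_Ioo_of_le zero_le_one] at h
  refine IntegrableOn.congr_fun h.re (fun t ht => ?_) measurableSet_Ioo
  have h1 : ((p + 1 : ℝ) : ℂ) - 1 = (p : ℂ) := by push_cast; ring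
  have h2 : ((q + 1 : ℝ) : ℂ) - 1 = (q : ℂ) := by push_cast; ring
  have h3 : (1 : ℂ) - t = ((1 - t : ℝ) : ℂ) := by push_cast; ring
  simp only [h1, h2, h3]
  rw [← Complex.ofReal_cpow ht.1.le, ← Complex.ofReal_cpow (by linarith [ht.2]),
    ← Complex.ofReal_mul]
  simp

section rescaledPeriod

variable {p q : ℝ} {h : ℝ → ℝ}

theorem mul_mem_Ico_of_mem {s t : ℝ} (hs : s ∈ Icc (0:ℝ) 1) (ht : t ∈ Ioo (0:ℝ) 1) :
    s * t ∈ Ico (0:ℝ) 1 :=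
  ⟨mul_nonneg hs.1 ht.1.le, by nlinarith [hs.1, hs.2, ht.1, ht.2]⟩

theorem rescaledPeriod_aestronglyMeasurable (hh : ContinuousOn h (Icc 0 1)) {s : ℝ}
    (hs : s ∈ Icc (0:ℝ) 1) :
    AEStronglyMeasurable (fun t : ℝ => t ^ p * (1 - t) ^ q * (1 - s * t) ^ p * h (s * t))
      (volume.restrict (Ioo 0 1)) := by
  refine ContinuousOn.aestronglyMeasurable ?_ measurableSet_Ioo
  refine ((ContinuousOn.mul ?_ ?_).mul ?_).mul ?_
  · exact continuousOn_id.rpow_const fun t ht => Or.inl ht.1.ne'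
  · exact (by fun_prop : ContinuousOn (fun t : ℝ => 1 - t) _).rpow_const
      fun t ht => Or.inl (sub_pos.2 ht.2).ne'
  · exact (by fun_prop : ContinuousOn (fun t : ℝ => 1 - s * t) _).rpow_const
      fun t ht => Or.inl (sub_pos.2 (mul_mem_Ico_of_mem hs ht).2).ne'
  · exact hh.comp (by fun_prop) fun t ht => Ico_subset_Icc_self (mul_mem_Ico_of_mem hs ht)

theorem rescaledPeriod_integrand_bound (hp' : p ≤ 0) {M : ℝ}
    (hM : ∀ u ∈ Icc (0:ℝ) 1, ‖h u‖ ≤ M) {s t : ℝ}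
    (hs : s ∈ Icc (0:ℝ) 1) (ht : t ∈ Ioo (0:ℝ) 1) :
    ‖t ^ p * (1 - t) ^ q * (1 - s * t) ^ p * h (s * t)‖ ≤ t ^ p * (1 - t) ^ (q + p) * M := by
  have hst := mul_mem_Ico_of_mem hs ht
  have h1 : 0 < 1 - t := sub_pos.2 ht.2
  have h2 : 1 - t ≤ 1 - s * t := by nlinarith [hs.2, ht.1]
  have h3 : (1 - s * t) ^ p ≤ (1 - t) ^ p := Real.rpow_le_rpow_of_nonpos h1 h2 hp'
  have h4 : 0 ≤ (1 - s * t) ^ p := Real.rpow_nonneg (sub_pos.2 hst.2).le _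
  have h5 : 0 ≤ t ^ p := Real.rpow_nonneg ht.1.le _
  have h6 : 0 ≤ (1 - t) ^ q := Real.rpow_nonneg h1.le _
  rw [norm_mul, Real.norm_of_nonneg (mul_nonneg (mul_nonneg h5 h6) h4), Real.rpow_add h1,
    ← mul_assoc (t ^ p)]
  gcongr
  exact hM _ (Ico_subset_Icc_self hst)

variable (hp : -1 < p) (hp' : p ≤ 0) (hq : -1 < q + p) (hh : ContinuousOn h (Icc 0 1))

include hp hp' hq hh

theorem rescaledPeriod_continuousOn : ContinuousOn (rescaledPeriod p q h) (Icc 0 1) := by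
  obtain ⟨M, hM⟩ := isCompact_Icc.exists_bound_of_continuousOn hh
  refine continuousOn_of_dominated (bound := fun t => t ^ p * (1 - t) ^ (q + p) * M)
    (fun s hs => rescaledPeriod_aestronglyMeasurable hh hs) (fun s hs => ?_)
    ((integrableOn_rpow_mul_one_sub_rpow hp hq).mul_const M) ?_
  · filter_upwards [ae_restrict_mem measurableSet_Ioo] with t ht
    exact rescaledPeriod_integrand_bound hp' hM hs ht
  · filter_upwards [ae_restrict_mem measurableSet_Ioo] with t ht
    refine (continuousOn_const.mul ?_).mul ?_
    · exact (by fun_prop : ContinuousOn (fun s : ℝ => 1 - s * t) _).rpow_const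
        fun s hs => Or.inl (sub_pos.2 (mul_mem_Ico_of_mem hs ht).2).ne'
    · exact hh.comp (by fun_prop) fun s hs => Ico_subset_Icc_self (mul_mem_Ico_of_mem hs ht)

theorem rescaledPeriod_pos (hpos : ∀ u ∈ Icc (0:ℝ) 1, 0 < h u) {s : ℝ}
    (hs : s ∈ Icc (0:ℝ) 1) : 0 < rescaledPeriod p q h s := by
  obtain ⟨M, hM⟩ := isCompact_Icc.exists_bound_of_continuousOn hh
  have hint : IntegrableOn (fun t : ℝ => t ^ p * (1 - t) ^ q * (1 - s * t) ^ p * h (s * t))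
      (Ioo 0 1) := by
    refine Integrable.mono' ((integrableOn_rpow_mul_one_sub_rpow hp hq).mul_const M)
      (rescaledPeriod_aestronglyMeasurable hh hs) ?_
    filter_upwards [ae_restrict_mem measurableSet_Ioo] with t ht
    exact rescaledPeriod_integrand_bound hp' hM hs ht
  have hpt : ∀ t ∈ Ioo (0:ℝ) 1, 0 < t ^ p * (1 - t) ^ q * (1 - s * t) ^ p * h (s * t) := by
    intro t ht
    have hst := mul_mem_Ico_of_mem hs ht
    exact mul_pos (mul_pos (mul_pos (Real.rpow_pos_of_pos ht.1 _)
      (Real.rpow_pos_of_pos (sub_pos.2 ht.2) _)) (Real.rpow_pos_of_pos (sub_pos.2 hst.2) _))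
      (hpos _ (Ico_subset_Icc_self hst))
  rw [rescaledPeriod, setIntegral_pos_iff_support_of_nonneg_ae _ hint]
  · rw [inter_eq_self_of_subset_right]
    · simp
    · exact fun t ht => (hpt t ht).ne'
  · filter_upwards [ae_restrict_mem measurableSet_Ioo] with t ht
    exact (hpt t ht).le

end rescaledPeriod

theorem setIntegral_Ioo_zero_eq_rescaledPeriod (p q : ℝ) (h : ℝ → ℝ) {a : ℝ} (ha : 0 < a) :
    ∫ z in Ioo 0 a, z ^ p * (a - z) ^ q * (1 - z) ^ p * h z =
      a ^ (p + q + 1) * rescaledPeriod p q h a := by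
  have key := intervalIntegral.integral_comp_mul_left (a := 0) (b := 1)
    (fun z => z ^ p * (a - z) ^ q * (1 - z) ^ p * h z) ha.ne'
  rw [mul_zero, mul_one, intervalIntegral.integral_of_le zero_le_one,
    intervalIntegral.integral_of_le ha.le, integral_Ioc_eq_integral_Ioo,
    integral_Ioc_eq_integral_Ioo, eq_inv_smul_iff₀ ha.ne', smul_eq_mul] at key
  have hscale : ∫ t in Ioo (0:ℝ) 1, (a * t) ^ p * (a - a * t) ^ q * (1 - a * t) ^ p * h (a * t) =
      a ^ p * a ^ q * rescaledPeriod p q h a := by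
    rw [rescaledPeriod, ← integral_const_mul]
    refine setIntegral_congr_fun measurableSet_Ioo fun t ht => ?_
    have h1 : a - a * t = a * (1 - t) := by ring
    simp only [h1]
    rw [Real.mul_rpow ha.le ht.1.le, Real.mul_rpow ha.le (sub_pos.2 ht.2).le]
    ring
  rw [← key, hscale, Real.rpow_add_one ha.ne', Real.rpow_add ha]
  ring

theorem setIntegral_Ioo_one_eq_rescaledPeriod (p q : ℝ) (h : ℝ → ℝ) {a : ℝ}
    (ha : a < 1) :
    ∫ z in Ioo a 1, z ^ p * (z - a) ^ q * (1 - z) ^ p * h z =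
      (1 - a) ^ (p + q + 1) * rescaledPeriod p q (fun u => h (1 - u)) (1 - a) := by
  rw [← setIntegral_Ioo_zero_eq_rescaledPeriod p q _ (sub_pos.2 ha)]
  have key := intervalIntegral.integral_comp_sub_left (a := 0) (b := 1 - a)
    (fun z => z ^ p * (z - a) ^ q * (1 - z) ^ p * h z) 1
  rw [sub_sub_cancel, sub_zero, intervalIntegral.integral_of_le (sub_pos.2 ha).le,
    intervalIntegral.integral_of_le ha.le, integral_Ioc_eq_integral_Ioo,
    integral_Ioc_eq_integral_Ioo] at key
  rw [← key]
  refine setIntegral_congr_fun measurableSet_Ioo fun t _ => ?_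
  have h1 : 1 - t - a = 1 - a - t := by ring
  simp only [h1, sub_sub_cancel]
  ring

theorem ss4_period_problem :
    ∀ b : ℝ, 1 < b → ∃ a : ℝ, 0 < a ∧ a < 1 ∧
      P1 a b / Q1 a b = P2 a b / Q2 a b := by
  intro b hb
  have hbase : ∀ u ∈ Icc (0:ℝ) 1, 0 < b - u := fun u hu => by linarith [hu.2]
  have hbase' : ∀ u ∈ Icc (0:ℝ) 1, 0 < b - (1 - u) := fun u hu => by linarith [hu.1]
  have hpos (r : ℝ) : ∀ u ∈ Icc (0:ℝ) 1, 0 < (b - u) ^ r :=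
    fun u hu => Real.rpow_pos_of_pos (hbase u hu) r
  have hpos' (r : ℝ) : ∀ u ∈ Icc (0:ℝ) 1, 0 < (b - (1 - u)) ^ r :=
    fun u hu => Real.rpow_pos_of_pos (hbase' u hu) r
  have hcont (r : ℝ) : ContinuousOn (fun u => (b - u) ^ r) (Icc (0:ℝ) 1) :=
    ContinuousOn.rpow_const (by fun_prop) fun u hu => Or.inl (hbase u hu).ne'
  have hcont' (r : ℝ) : ContinuousOn (fun u => (b - (1 - u)) ^ r) (Icc (0:ℝ) 1) :=
    ContinuousOn.rpow_const (by fun_prop) fun u hu => Or.inl (hbase' u hu).ne'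
  set p₁ := rescaledPeriod (-(3:ℝ)/4) ((1:ℝ)/2) (fun u => (b - (1 - u)) ^ (-(1:ℝ)/4)) with hp₁
  set q₁ := rescaledPeriod (-(3:ℝ)/4) ((1:ℝ)/2) (fun u => (b - u) ^ (-(1:ℝ)/4)) with hq₁
  set p₂ := rescaledPeriod (-(1:ℝ)/4) (-(1:ℝ)/2) (fun u => (b - (1 - u)) ^ (-(3:ℝ)/4)) with hp₂
  set q₂ := rescaledPeriod (-(1:ℝ)/4) (-(1:ℝ)/2) (fun u => (b - u) ^ (-(3:ℝ)/4)) with hq₂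
  have cp₁ : ContinuousOn p₁ (Icc 0 1) :=
    rescaledPeriod_continuousOn (by norm_num) (by norm_num) (by norm_num) (hcont' _)
  have cq₁ : ContinuousOn q₁ (Icc 0 1) :=
    rescaledPeriod_continuousOn (by norm_num) (by norm_num) (by norm_num) (hcont _)
  have cp₂ : ContinuousOn p₂ (Icc 0 1) :=
    rescaledPeriod_continuousOn (by norm_num) (by norm_num) (by norm_num) (hcont' _)
  have cq₂ : ContinuousOn q₂ (Icc 0 1) :=
    rescaledPeriod_continuousOn (by norm_num) (by norm_num) (by norm_num) (hcont _)
  have pp₁ : ∀ s ∈ Icc (0:ℝ) 1, 0 < p₁ s := fun s hs =>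
    rescaledPeriod_pos (by norm_num) (by norm_num) (by norm_num) (hcont' _) (hpos' _) hs
  have pq₁ : ∀ s ∈ Icc (0:ℝ) 1, 0 < q₁ s := fun s hs =>
    rescaledPeriod_pos (by norm_num) (by norm_num) (by norm_num) (hcont _) (hpos _) hs
  have pp₂ : ∀ s ∈ Icc (0:ℝ) 1, 0 < p₂ s := fun s hs =>
    rescaledPeriod_pos (by norm_num) (by norm_num) (by norm_num) (hcont' _) (hpos' _) hs
  have pq₂ : ∀ s ∈ Icc (0:ℝ) 1, 0 < q₂ s := fun s hs =>
    rescaledPeriod_pos (by norm_num) (by norm_num) (by norm_num) (hcont _) (hpos _) hs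
  have hmaps : MapsTo (fun a : ℝ => 1 - a) (Icc 0 1) (Icc 0 1) :=
    fun a ha => ⟨sub_nonneg.2 ha.2, by linarith [ha.1]⟩
  have hsub : ContinuousOn (fun a : ℝ => 1 - a) (Icc 0 1) := by fun_prop
  let F : ℝ → ℝ := fun a =>
    a ^ ((1:ℝ)/2) * p₂ (1 - a) * q₁ a - (1 - a) ^ ((1:ℝ)/2) * p₁ (1 - a) * q₂ a
  have hF : ContinuousOn F (Icc 0 1) := by
    refine ContinuousOn.sub (ContinuousOn.mul (ContinuousOn.mul ?_ (cp₂.comp hsub hmaps)) cq₁)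
      (ContinuousOn.mul (ContinuousOn.mul ?_ (cp₁.comp hsub hmaps)) cq₂)
    · exact continuousOn_id.rpow_const fun _ _ => Or.inr (by norm_num)
    · exact hsub.rpow_const fun _ _ => Or.inr (by norm_num)
  have h0 : (0:ℝ) ∈ Icc (0:ℝ) 1 := ⟨le_rfl, zero_le_one⟩
  have h1 : (1:ℝ) ∈ Icc (0:ℝ) 1 := ⟨zero_le_one, le_rfl⟩
  have hF0 : F 0 < 0 := by
    have := mul_pos (pp₁ 1 h1) (pq₂ 0 h0)
    simpa [F] using this
  have hF1 : 0 < F 1 := by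
    have := mul_pos (pp₂ 0 h0) (pq₁ 1 h1)
    simpa [F] using this
  obtain ⟨a, ⟨ha, ha'⟩, hFa⟩ := intermediate_value_Ioo zero_le_one hF ⟨hF0, hF1⟩
  refine ⟨a, ha, ha', ?_⟩
  have hc : 0 < 1 - a := sub_pos.2 ha'
  have haI : a ∈ Icc (0:ℝ) 1 := ⟨ha.le, ha'.le⟩
  have eP₁ : P1 a b = (1 - a) ^ ((3:ℝ)/4) * p₁ (1 - a) := by
    rw [P1, setIntegral_Ioo_one_eq_rescaledPeriod _ _ (fun z => (b - z) ^ (-(1:ℝ)/4)) ha']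
    norm_num [hp₁]
  have eQ₁ : Q1 a b = a ^ ((3:ℝ)/4) * q₁ a := by
    rw [Q1, setIntegral_Ioo_zero_eq_rescaledPeriod _ _ (fun z => (b - z) ^ (-(1:ℝ)/4)) ha]
    norm_num [hq₁]
  have eP₂ : P2 a b = (1 - a) ^ ((1:ℝ)/4) * p₂ (1 - a) := by
    rw [P2, setIntegral_Ioo_one_eq_rescaledPeriod _ _ (fun z => (b - z) ^ (-(3:ℝ)/4)) ha']
    norm_num [hp₂]
  have eQ₂ : Q2 a b = a ^ ((1:ℝ)/4) * q₂ a := by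
    rw [Q2, setIntegral_Ioo_zero_eq_rescaledPeriod _ _ (fun z => (b - z) ^ (-(3:ℝ)/4)) ha]
    norm_num [hq₂]
  have split (x : ℝ) (hx : 0 < x) : x ^ ((3:ℝ)/4) = x ^ ((1:ℝ)/2) * x ^ ((1:ℝ)/4) := by
    rw [← Real.rpow_add hx]; norm_num
  rw [eP₁, eQ₁, eP₂, eQ₂, div_eq_div_iff
    (mul_pos (Real.rpow_pos_of_pos ha _) (pq₁ a haI)).ne'
    (mul_pos (Real.rpow_pos_of_pos ha _) (pq₂ a haI)).ne', split _ ha, split _ hc]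
  have hFa' : a ^ ((1:ℝ)/2) * p₂ (1 - a) * q₁ a = (1 - a) ^ ((1:ℝ)/2) * p₁ (1 - a) * q₂ a :=
    sub_eq_zero.1 hFa
  linear_combination (-(a ^ ((1:ℝ)/4) * (1 - a) ^ ((1:ℝ)/4))) * hFa'
end

section
/- For each fixed real b > 1 there exist constants C > 0 and δ ∈ (0,1) such that for all a ∈ (0,δ): 1/C ≤ P₁(a,b) ≤ C and 1/C ≤ P₂(a,b) ≤ C. (The integrals over (a,1) stay bounded above and below as a → 0⁺.) -/
open MeasureTheory Set

lemma intervalIntegrable_sub_rpow {a p : ℝ} (hp : -1 < p) :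
    IntervalIntegrable (fun z : ℝ => (z - a) ^ p) volume a 1 := by
  simpa using (intervalIntegral.intervalIntegrable_rpow' (a := 0) (b := 1 - a) hp).comp_sub_right a

lemma intervalIntegrable_one_sub_rpow {a p : ℝ} (hp : -1 < p) :
    IntervalIntegrable (fun z : ℝ => (1 - z) ^ p) volume a 1 := by
  simpa using (intervalIntegral.intervalIntegrable_rpow' (a := 1 - a) (b := 0) hp).comp_sub_left 1

/-- The function `(z - a)^p + (1 - z)^p` is integrable on `(a, 1)` for `p > -1`. -/
lemma integrableOn_sub_rpow_add_sub_rpow {a p : ℝ} (ha : a ≤ 1) (hp : -1 < p) :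
    IntegrableOn (fun z : ℝ => (z - a) ^ p + (1 - z) ^ p) (Ioo a 1) := by
  rw [← intervalIntegrable_iff_integrableOn_Ioo_of_le ha]
  exact (intervalIntegrable_sub_rpow hp).add (intervalIntegrable_one_sub_rpow hp)

lemma setIntegral_sub_rpow_add_sub_rpow {a p : ℝ} (ha : a ≤ 1) (hp : -1 < p) :
    ∫ z in Ioo a 1, ((z - a) ^ p + (1 - z) ^ p) = 2 * (1 - a) ^ (p + 1) / (p + 1) := by
  rw [← integral_Ioc_eq_integral_Ioo, ← intervalIntegral.integral_of_le ha,
    intervalIntegral.integral_add]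
  · rw [intervalIntegral.integral_comp_sub_right (fun x => x ^ p) a,
      intervalIntegral.integral_comp_sub_left (fun x => x ^ p) 1, sub_self, sub_self,
      integral_rpow (Or.inl hp), Real.zero_rpow (by linarith)]
    ring
  · exact intervalIntegrable_sub_rpow hp
  · exact intervalIntegrable_one_sub_rpow hp

lemma rpow_mul_rpow_le_of_half_le_add {u v : ℝ} (hu : 0 < u) (hv : 0 < v) (huv : 1 / 2 ≤ u + v) :
    u ^ (-(3:ℝ)/4) * v ^ (-(3:ℝ)/4) ≤ 4 * (u ^ (-(3:ℝ)/4) + v ^ (-(3:ℝ)/4)) := by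
  have key : ∀ x : ℝ, 1 / 4 ≤ x → x ^ (-(3:ℝ)/4) ≤ 4 := fun x hx => by
    calc x ^ (-(3:ℝ)/4) ≤ (1 / 4 : ℝ) ^ (-(3:ℝ)/4) :=
          Real.rpow_le_rpow_of_nonpos (by norm_num) hx (by norm_num)
      _ ≤ (1 / 4 : ℝ) ^ (-1 : ℝ) :=
          Real.rpow_le_rpow_of_exponent_ge (by norm_num) (by norm_num) (by norm_num)
      _ = 4 := by rw [Real.rpow_neg_one]; norm_num
  have hu' : 0 < u ^ (-(3:ℝ)/4) := Real.rpow_pos_of_pos hu _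
  have hv' : 0 < v ^ (-(3:ℝ)/4) := Real.rpow_pos_of_pos hv _
  rcases le_or_gt (1 / 4) u with h | h
  · nlinarith [key u h]
  · nlinarith [key v (by linarith)]

/-- A measurable function on `(a, 1)` dominated by `K (z - a)^{-3/4} (1 - z)^{-3/4}` and bounded
below by `m` on `(1/2, 1)` has integral between `m / 2` and `32 K`. -/
lemma setIntegral_bounds {f : ℝ → ℝ} {a K m : ℝ} (ha : 0 < a) (ha' : a ≤ 1 / 2) (hK : 0 ≤ K)
    (hf : Measurable f) (hf0 : ∀ z ∈ Ioo a 1, 0 ≤ f z)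
    (hfK : ∀ z ∈ Ioo a 1, f z ≤ K * ((z - a) ^ (-(3:ℝ)/4) * (1 - z) ^ (-(3:ℝ)/4)))
    (hfm : ∀ z ∈ Ioo (1 / 2 : ℝ) 1, m ≤ f z) :
    m / 2 ≤ ∫ z in Ioo a 1, f z ∧ ∫ z in Ioo a 1, f z ≤ 32 * K := by
  have hle : ∀ z ∈ Ioo a 1,
      f z ≤ K * 4 * ((z - a) ^ (-(3:ℝ)/4) + (1 - z) ^ (-(3:ℝ)/4)) := fun z hz => by
    refine (hfK z hz).trans ?_
    rw [mul_assoc]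
    exact mul_le_mul_of_nonneg_left
      (rpow_mul_rpow_le_of_half_le_add (sub_pos.2 hz.1) (sub_pos.2 hz.2) (by linarith)) hK
  have hg := (integrableOn_sub_rpow_add_sub_rpow (a := a) (p := -(3:ℝ)/4) (by linarith)
    (by norm_num)).const_mul (K * 4)
  have hfi : IntegrableOn f (Ioo a 1) := by
    refine Integrable.mono' hg hf.aestronglyMeasurable ?_
    filter_upwards [ae_restrict_mem measurableSet_Ioo] with z hz
    rw [Real.norm_of_nonneg (hf0 z hz)]
    exact hle z hz
  have hsub : Ioo (1 / 2 : ℝ) 1 ⊆ Ioo a 1 := Ioo_subset_Ioo_left ha'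
  constructor
  · calc m / 2 = ∫ _ in Ioo (1 / 2 : ℝ) 1, m := by
          rw [setIntegral_const, measureReal_def, Real.volume_Ioo,
            ENNReal.toReal_ofReal (by norm_num), smul_eq_mul]
          ring
      _ ≤ ∫ z in Ioo (1 / 2 : ℝ) 1, f z :=
          setIntegral_mono_on (integrableOn_const (by simp)) (hfi.mono_set hsub)
            measurableSet_Ioo hfm
      _ ≤ ∫ z in Ioo a 1, f z := by
          refine setIntegral_mono_set hfi ?_ hsub.eventuallyLE
          filter_upwards [ae_restrict_mem measurableSet_Ioo] with z hz using hf0 z hz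
  · calc ∫ z in Ioo a 1, f z
        ≤ ∫ z in Ioo a 1, K * 4 * ((z - a) ^ (-(3:ℝ)/4) + (1 - z) ^ (-(3:ℝ)/4)) :=
          setIntegral_mono_on hfi hg measurableSet_Ioo hle
      _ = 32 * K * (1 - a) ^ (-(3:ℝ)/4 + 1) := by
          rw [integral_const_mul, setIntegral_sub_rpow_add_sub_rpow (by linarith) (by norm_num)]
          ring
      _ ≤ 32 * K :=
          mul_le_of_le_one_right (by positivity)
            (Real.rpow_le_one (by linarith) (by linarith) (by norm_num))

lemma P1_bounds {a b : ℝ} (hb : 1 < b) (ha : 0 < a) (ha' : a ≤ 1 / 4) :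
    b ^ (-(1:ℝ)/4) / 4 ≤ P1 a b ∧ P1 a b ≤ 32 * (b - 1) ^ (-(1:ℝ)/4) := by
  have hb1 : 0 < b - 1 := sub_pos.2 hb
  have h := setIntegral_bounds (a := a) (K := (b - 1) ^ (-(1:ℝ)/4)) (m := b ^ (-(1:ℝ)/4) / 2)
    (f := fun z => z ^ (-(3:ℝ)/4) * (z - a) ^ ((1:ℝ)/2) * (1 - z) ^ (-(3:ℝ)/4)
      * (b - z) ^ (-(1:ℝ)/4)) ha (by linarith) (by positivity) (by fun_prop) ?_ ?_ ?_
  · refine ⟨?_, h.2⟩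
    have := h.1
    rw [P1]
    linarith
  · rintro z ⟨hz, hz1⟩
    have h1 : 0 ≤ z := by linarith
    have h2 : 0 ≤ z - a := by linarith
    have h3 : 0 ≤ 1 - z := by linarith
    have h4 : 0 ≤ b - z := by linarith
    positivity
  · rintro z ⟨hz, hz1⟩
    have h1 : 0 < z := by linarith
    have h2 : 0 < z - a := by linarith
    have h3 : 0 < 1 - z := by linarith
    have h4 : 0 < b - z := by linarith
    have e1 : z ^ (-(3:ℝ)/4) ≤ (z - a) ^ (-(3:ℝ)/4) :=
      Real.rpow_le_rpow_of_nonpos h2 (by linarith) (by norm_num)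
    have e2 : (z - a) ^ ((1:ℝ)/2) ≤ 1 := Real.rpow_le_one h2.le (by linarith) (by norm_num)
    have e4 : (b - z) ^ (-(1:ℝ)/4) ≤ (b - 1) ^ (-(1:ℝ)/4) :=
      Real.rpow_le_rpow_of_nonpos hb1 (by linarith) (by norm_num)
    calc z ^ (-(3:ℝ)/4) * (z - a) ^ ((1:ℝ)/2) * (1 - z) ^ (-(3:ℝ)/4) * (b - z) ^ (-(1:ℝ)/4)
        ≤ (z - a) ^ (-(3:ℝ)/4) * 1 * (1 - z) ^ (-(3:ℝ)/4) * (b - 1) ^ (-(1:ℝ)/4) := by gcongr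
      _ = _ := by ring
  · rintro z ⟨hz, hz1⟩
    have h3 : 0 < 1 - z := by linarith
    have h4 : 0 < b - z := by linarith
    have e1 : 1 ≤ z ^ (-(3:ℝ)/4) :=
      Real.one_le_rpow_of_pos_of_le_one_of_nonpos (by linarith) hz1.le (by norm_num)
    have e2 : 1 / 2 ≤ (z - a) ^ ((1:ℝ)/2) := by
      rw [← Real.sqrt_eq_rpow]
      exact Real.le_sqrt_of_sq_le (by linarith)
    have e3 : 1 ≤ (1 - z) ^ (-(3:ℝ)/4) :=
      Real.one_le_rpow_of_pos_of_le_one_of_nonpos h3 (by linarith) (by norm_num)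
    have e4 : b ^ (-(1:ℝ)/4) ≤ (b - z) ^ (-(1:ℝ)/4) :=
      Real.rpow_le_rpow_of_nonpos h4 (by linarith) (by norm_num)
    have hb0 : 0 < b := by linarith
    calc b ^ (-(1:ℝ)/4) / 2 = 1 * (1 / 2) * 1 * b ^ (-(1:ℝ)/4) := by ring
      _ ≤ _ := by gcongr

lemma P2_bounds {a b : ℝ} (hb : 1 < b) (ha : 0 < a) (ha' : a ≤ 1 / 4) :
    b ^ (-(3:ℝ)/4) / 2 ≤ P2 a b ∧ P2 a b ≤ 32 * (b - 1) ^ (-(3:ℝ)/4) := by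
  have hb1 : 0 < b - 1 := sub_pos.2 hb
  refine setIntegral_bounds (a := a) (K := (b - 1) ^ (-(3:ℝ)/4)) (m := b ^ (-(3:ℝ)/4))
    ha (by linarith) (by positivity) (by fun_prop) ?_ ?_ ?_
  · rintro z ⟨hz, hz1⟩
    have h1 : 0 ≤ z := by linarith
    have h2 : 0 ≤ z - a := by linarith
    have h3 : 0 ≤ 1 - z := by linarith
    have h4 : 0 ≤ b - z := by linarith
    positivity
  · rintro z ⟨hz, hz1⟩
    have h1 : 0 < z := by linarith
    have h2 : 0 < z - a := by linarith
    have h3 : 0 < 1 - z := by linarith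
    have h4 : 0 < b - z := by linarith
    have e1 : z ^ (-(1:ℝ)/4) ≤ (z - a) ^ (-(1:ℝ)/4) :=
      Real.rpow_le_rpow_of_nonpos h2 (by linarith) (by norm_num)
    have e2 : (z - a) ^ (-(1:ℝ)/4) * (z - a) ^ (-(1:ℝ)/2) = (z - a) ^ (-(3:ℝ)/4) := by
      rw [← Real.rpow_add h2]
      norm_num
    have e3 : (1 - z) ^ (-(1:ℝ)/4) ≤ (1 - z) ^ (-(3:ℝ)/4) :=
      Real.rpow_le_rpow_of_exponent_ge h3 (by linarith) (by norm_num)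
    have e4 : (b - z) ^ (-(3:ℝ)/4) ≤ (b - 1) ^ (-(3:ℝ)/4) :=
      Real.rpow_le_rpow_of_nonpos hb1 (by linarith) (by norm_num)
    calc z ^ (-(1:ℝ)/4) * (z - a) ^ (-(1:ℝ)/2) * (1 - z) ^ (-(1:ℝ)/4) * (b - z) ^ (-(3:ℝ)/4)
        ≤ (z - a) ^ (-(1:ℝ)/4) * (z - a) ^ (-(1:ℝ)/2) * (1 - z) ^ (-(3:ℝ)/4)
          * (b - 1) ^ (-(3:ℝ)/4) := by gcongr
      _ = _ := by rw [e2]; ring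
  · rintro z ⟨hz, hz1⟩
    have h3 : 0 < 1 - z := by linarith
    have h4 : 0 < b - z := by linarith
    have e1 : 1 ≤ z ^ (-(1:ℝ)/4) :=
      Real.one_le_rpow_of_pos_of_le_one_of_nonpos (by linarith) hz1.le (by norm_num)
    have e2 : 1 ≤ (z - a) ^ (-(1:ℝ)/2) :=
      Real.one_le_rpow_of_pos_of_le_one_of_nonpos (by linarith) (by linarith) (by norm_num)
    have e3 : 1 ≤ (1 - z) ^ (-(1:ℝ)/4) :=
      Real.one_le_rpow_of_pos_of_le_one_of_nonpos h3 (by linarith) (by norm_num)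
    have e4 : b ^ (-(3:ℝ)/4) ≤ (b - z) ^ (-(3:ℝ)/4) :=
      Real.rpow_le_rpow_of_nonpos h4 (by linarith) (by norm_num)
    have hb0 : 0 < b := by linarith
    calc b ^ (-(3:ℝ)/4) = 1 * 1 * 1 * b ^ (-(3:ℝ)/4) := by ring
      _ ≤ _ := by gcongr

theorem ss4_P_bounded_near_zero :
    ∀ b : ℝ, 1 < b → ∃ C δ : ℝ, 0 < C ∧ δ ∈ Ioo (0:ℝ) 1 ∧
      ∀ a ∈ Ioo (0:ℝ) δ,
        1 / C ≤ P1 a b ∧ P1 a b ≤ C ∧ 1 / C ≤ P2 a b ∧ P2 a b ≤ C := by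
  intro b hb
  have hb0 : 0 < b := by linarith
  have hb1 : 0 < b - 1 := sub_pos.2 hb
  have hm₁ : 0 < b ^ (-(1:ℝ)/4) / 4 := by positivity
  have hm₂ : 0 < b ^ (-(3:ℝ)/4) / 2 := by positivity
  have hM₁ : 0 < 32 * (b - 1) ^ (-(1:ℝ)/4) := by positivity
  have hM₂ : 0 < 32 * (b - 1) ^ (-(3:ℝ)/4) := by positivity
  have hi₁ := inv_pos.2 hm₁
  have hi₂ := inv_pos.2 hm₂
  refine ⟨(b ^ (-(1:ℝ)/4) / 4)⁻¹ + (b ^ (-(3:ℝ)/4) / 2)⁻¹ + 32 * (b - 1) ^ (-(1:ℝ)/4)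
    + 32 * (b - 1) ^ (-(3:ℝ)/4), 1 / 4, by linarith, by norm_num, ?_⟩
  rintro a ⟨ha, ha'⟩
  obtain ⟨l₁, u₁⟩ := P1_bounds hb ha ha'.le
  obtain ⟨l₂, u₂⟩ := P2_bounds hb ha ha'.le
  refine ⟨le_trans ?_ l₁, by linarith, le_trans ?_ l₂, by linarith⟩
  · rw [one_div]
    exact inv_le_of_inv_le₀ hm₁ (by linarith)
  · rw [one_div]
    exact inv_le_of_inv_le₀ hm₂ (by linarith)
end

section
/- For each fixed real b > 1 there exists δ ∈ (0,1) such that for all a ∈ (0,δ): P₁(a,b)/Q₁(a,b) > P₂(a,b)/Q₂(a,b). (One side of the intermediate-value argument for the SS-4 period problem, near a = 0.) -/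
open MeasureTheory Set

lemma integrableOn_sub_left_rpow (a c : ℝ) (h : a ≤ c) :
    IntegrableOn (fun z : ℝ => (z - a) ^ (-(3:ℝ)/4)) (Ioo a c) := by
  have h1 : IntervalIntegrable (fun x : ℝ => x ^ (-(3:ℝ)/4)) volume (a - a) (c - a) :=
    intervalIntegral.intervalIntegrable_rpow' (by norm_num)
  have h2 := h1.comp_sub_right a
  simp only [sub_add_cancel] at h2
  exact ((intervalIntegrable_iff_integrableOn_Ioc_of_le h).1 h2).mono_set Ioo_subset_Ioc_self

lemma integrableOn_sub_right_rpow (a c : ℝ) (h : a ≤ c) :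
    IntegrableOn (fun z : ℝ => (c - z) ^ (-(3:ℝ)/4)) (Ioo a c) := by
  have h1 : IntervalIntegrable (fun x : ℝ => x ^ (-(3:ℝ)/4)) volume (c - a) (c - c) :=
    intervalIntegral.intervalIntegrable_rpow' (by norm_num)
  have h2 := h1.comp_sub_left c
  simp only [sub_sub_cancel] at h2
  exact ((intervalIntegrable_iff_integrableOn_Ioc_of_le h).1 h2).mono_set Ioo_subset_Ioc_self

lemma setIntegral_sub_left_rpow (a c : ℝ) (h : a ≤ c) :
    ∫ z in Ioo a c, (z - a) ^ (-(3:ℝ)/4) = 4 * (c - a) ^ ((1:ℝ)/4) := by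
  rw [← integral_Ioc_eq_integral_Ioo, ← intervalIntegral.integral_of_le h,
    intervalIntegral.integral_comp_sub_right (fun x : ℝ => x ^ (-(3:ℝ)/4)),
    integral_rpow (Or.inl (by norm_num)), sub_self, Real.zero_rpow (by norm_num)]
  norm_num
  ring

lemma setIntegral_sub_right_rpow (a c : ℝ) (h : a ≤ c) :
    ∫ z in Ioo a c, (c - z) ^ (-(3:ℝ)/4) = 4 * (c - a) ^ ((1:ℝ)/4) := by
  rw [← integral_Ioc_eq_integral_Ioo, ← intervalIntegral.integral_of_le h,
    intervalIntegral.integral_comp_sub_left (fun x : ℝ => x ^ (-(3:ℝ)/4)),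
    integral_rpow (Or.inl (by norm_num)), sub_self, Real.zero_rpow (by norm_num)]
  norm_num
  ring

lemma rpow_mul_rpow_le_add {u v : ℝ} (hu : 0 < u) (hv : 0 < v) :
    u ^ (-(1:ℝ)/4) * v ^ (-(1:ℝ)/2) ≤ u ^ (-(3:ℝ)/4) + v ^ (-(3:ℝ)/4) := by
  have hu' : (0:ℝ) < u ^ (-(3:ℝ)/4) := by positivity
  have hv' : (0:ℝ) < v ^ (-(3:ℝ)/4) := by positivity
  rcases le_total u v with h | h
  · have : u ^ (-(1:ℝ)/4) * v ^ (-(1:ℝ)/2) ≤ u ^ (-(1:ℝ)/4) * u ^ (-(1:ℝ)/2) := by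
      gcongr ?_ * ?_
      exact Real.rpow_le_rpow_of_nonpos hu h (by norm_num)
    rw [← Real.rpow_add hu] at this
    norm_num at this ⊢
    linarith
  · have : u ^ (-(1:ℝ)/4) * v ^ (-(1:ℝ)/2) ≤ v ^ (-(1:ℝ)/4) * v ^ (-(1:ℝ)/2) := by
      gcongr ?_ * ?_
      exact Real.rpow_le_rpow_of_nonpos hv h (by norm_num)
    rw [← Real.rpow_add hv] at this
    norm_num at this ⊢
    linarith

lemma rpow_neg_le_two {x p : ℝ} (hx : 1 / 2 ≤ x) (hp : -1 ≤ p) (hp' : p ≤ 0) : x ^ p ≤ 2 :=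
  calc x ^ p ≤ (1 / 2 : ℝ) ^ p := Real.rpow_le_rpow_of_nonpos (by norm_num) hx hp'
    _ ≤ (1 / 2 : ℝ) ^ (-1 : ℝ) :=
      Real.rpow_le_rpow_of_exponent_ge (by norm_num) (by norm_num) hp
    _ = 2 := by rw [Real.rpow_neg_one]; norm_num

lemma le_P1 {a b : ℝ} (ha : 0 < a) (ha' : a < 1 / 4) (hb : 1 < b) :
    b ^ (-(1:ℝ)/4) / 8 ≤ P1 a b := by
  have hint : IntegrableOn (fun z : ℝ => z ^ (-(3:ℝ)/4) * (z - a) ^ ((1:ℝ)/2) *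
      (1 - z) ^ (-(3:ℝ)/4) * (b - z) ^ (-(1:ℝ)/4)) (Ioo a 1) := by
    refine Integrable.mono' (((integrableOn_sub_right_rpow a 1 (by linarith)).const_mul
      (a ^ (-(3:ℝ)/4))).mul_const ((b - 1) ^ (-(1:ℝ)/4)))
      (Measurable.aestronglyMeasurable (by fun_prop)) ?_
    filter_upwards [ae_restrict_mem measurableSet_Ioo] with z ⟨hz, hz'⟩
    have h1 : 0 < z := by linarith
    have h2 : 0 < z - a := by linarith
    have h3 : 0 < 1 - z := by linarith
    have h4 : 0 < b - z := by linarith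
    have h5 : 0 < b - 1 := by linarith
    rw [Real.norm_of_nonneg (by positivity)]
    have e1 := Real.rpow_le_rpow_of_nonpos ha hz.le (show -(3:ℝ)/4 ≤ 0 by norm_num)
    have e2 := Real.rpow_le_one h2.le (by linarith) (show (0:ℝ) ≤ 1/2 by norm_num)
    have e3 := Real.rpow_le_rpow_of_nonpos h5 (show b - 1 ≤ b - z by linarith)
      (show -(1:ℝ)/4 ≤ 0 by norm_num)
    calc _ ≤ a ^ (-(3:ℝ)/4) * 1 * (1 - z) ^ (-(3:ℝ)/4) * (b - 1) ^ (-(1:ℝ)/4) := by gcongr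
      _ = _ := by ring
  have hsub : Ioo (1/2 : ℝ) 1 ⊆ Ioo a 1 := Ioo_subset_Ioo_left (by linarith)
  calc b ^ (-(1:ℝ)/4) / 8 = ∫ _ in Ioo (1/2 : ℝ) 1, b ^ (-(1:ℝ)/4) / 4 := by
        norm_num [setIntegral_const]
        ring
    _ ≤ ∫ z in Ioo (1/2 : ℝ) 1, z ^ (-(3:ℝ)/4) * (z - a) ^ ((1:ℝ)/2) *
          (1 - z) ^ (-(3:ℝ)/4) * (b - z) ^ (-(1:ℝ)/4) := by
        refine setIntegral_mono_on (integrableOn_const (by simp)) (hint.mono_set hsub) measurableSet_Ioo ?_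
        rintro z ⟨hz, hz'⟩
        have h1 : 0 < z := by linarith
        have h2 : 0 < z - a := by linarith
        have h3 : 0 < 1 - z := by linarith
        have h4 : 0 < b - z := by linarith
        have e1 := Real.one_le_rpow_of_pos_of_le_one_of_nonpos h1 hz'.le
          (show -(3:ℝ)/4 ≤ 0 by norm_num)
        have e3 := Real.one_le_rpow_of_pos_of_le_one_of_nonpos h3 (by linarith)
          (show -(3:ℝ)/4 ≤ 0 by norm_num)
        have e2 : 1 / 4 ≤ (z - a) ^ ((1:ℝ)/2) := by
          have := Real.rpow_le_rpow_of_exponent_ge h2 (by linarith)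
            (show (1:ℝ)/2 ≤ 1 by norm_num)
          rw [Real.rpow_one] at this
          linarith
        have e4 := Real.rpow_le_rpow_of_nonpos h4 (show b - z ≤ b by linarith)
          (show -(1:ℝ)/4 ≤ 0 by norm_num)
        calc b ^ (-(1:ℝ)/4) / 4 = 1 * (1 / 4) * 1 * b ^ (-(1:ℝ)/4) := by ring
          _ ≤ _ := by gcongr
    _ ≤ P1 a b := by
        refine setIntegral_mono_set hint ?_ hsub.eventuallyLE
        filter_upwards [ae_restrict_mem measurableSet_Ioo] with z ⟨hz, hz'⟩
        have h1 : 0 < z := by linarith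
        have h2 : 0 < z - a := by linarith
        have h3 : 0 < 1 - z := by linarith
        have h4 : 0 < b - z := by linarith
        simp only [Pi.zero_apply]
        positivity

lemma P2_le {a b : ℝ} (ha : 0 < a) (ha' : a < 1 / 4) (hb : 1 < b) :
    P2 a b ≤ 16 * (b - 1) ^ (-(3:ℝ)/4) := by
  have h5 : 0 < b - 1 := by linarith
  have i1 := integrableOn_sub_left_rpow a 1 (by linarith)
  have i2 := integrableOn_sub_right_rpow a 1 (by linarith)
  calc P2 a b ≤ ∫ z in Ioo a 1, 2 * (b - 1) ^ (-(3:ℝ)/4) *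
        ((z - a) ^ (-(3:ℝ)/4) + (1 - z) ^ (-(3:ℝ)/4)) := by
        refine integral_mono_of_nonneg ?_ ((i1.add i2).const_mul _) ?_
        all_goals
          filter_upwards [ae_restrict_mem measurableSet_Ioo] with z ⟨hz, hz'⟩
          have h1 : 0 < z := by linarith
          have h2 : 0 < z - a := by linarith
          have h3 : 0 < 1 - z := by linarith
          have h4 : 0 < b - z := by linarith
        · simp only [Pi.zero_apply]
          positivity
        · have e4 := Real.rpow_le_rpow_of_nonpos h5 (show b - 1 ≤ b - z by linarith)
            (show -(3:ℝ)/4 ≤ 0 by norm_num)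
          have key : z ^ (-(1:ℝ)/4) * (z - a) ^ (-(1:ℝ)/2) * (1 - z) ^ (-(1:ℝ)/4) ≤
              2 * ((z - a) ^ (-(3:ℝ)/4) + (1 - z) ^ (-(3:ℝ)/4)) := by
            rcases le_total (1/2) z with h | h
            · have e1 : z ^ (-(1:ℝ)/4) ≤ 2 := rpow_neg_le_two h (by norm_num) (by norm_num)
              calc _ = z ^ (-(1:ℝ)/4) * ((1 - z) ^ (-(1:ℝ)/4) * (z - a) ^ (-(1:ℝ)/2)) := by ring
                _ ≤ 2 * ((1 - z) ^ (-(3:ℝ)/4) + (z - a) ^ (-(3:ℝ)/4)) := by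
                    gcongr
                    exact rpow_mul_rpow_le_add h3 h2
                _ = _ := by ring
            · have e1 : (1 - z) ^ (-(1:ℝ)/4) ≤ 2 :=
                rpow_neg_le_two (by linarith) (by norm_num) (by norm_num)
              have e2 := Real.rpow_le_rpow_of_nonpos h2 (show z - a ≤ z by linarith)
                (show -(1:ℝ)/4 ≤ 0 by norm_num)
              have e3 : (z - a) ^ (-(1:ℝ)/4) * (z - a) ^ (-(1:ℝ)/2) = (z - a) ^ (-(3:ℝ)/4) := by
                rw [← Real.rpow_add h2]; norm_num
              have e5 : 0 < (1 - z) ^ (-(3:ℝ)/4) := by positivity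
              calc _ ≤ (z - a) ^ (-(1:ℝ)/4) * (z - a) ^ (-(1:ℝ)/2) * 2 := by gcongr
                _ ≤ _ := by rw [e3]; linarith
          calc _ ≤ 2 * ((z - a) ^ (-(3:ℝ)/4) + (1 - z) ^ (-(3:ℝ)/4)) *
                (b - 1) ^ (-(3:ℝ)/4) := by gcongr
            _ = _ := by ring
    _ = 16 * (b - 1) ^ (-(3:ℝ)/4) * (1 - a) ^ ((1:ℝ)/4) := by
        rw [integral_const_mul, integral_add i1 i2,
          setIntegral_sub_left_rpow _ _ (by linarith), setIntegral_sub_right_rpow _ _ (by linarith)]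
        ring
    _ ≤ 16 * (b - 1) ^ (-(3:ℝ)/4) * 1 := by
        gcongr
        exact Real.rpow_le_one (by linarith) (by linarith) (by norm_num)
    _ = _ := mul_one _

lemma Q1_bounds {a b : ℝ} (ha : 0 < a) (ha' : a < 1 / 4) (hb : 1 < b) :
    0 < Q1 a b ∧ Q1 a b ≤ 8 * (b - 1) ^ (-(1:ℝ)/4) * (a ^ ((1:ℝ)/4) * a ^ ((1:ℝ)/2)) := by
  have h5 : 0 < b - 1 := by linarith
  have i0 := integrableOn_sub_left_rpow 0 a ha.le
  have hnn : 0 ≤ᵐ[volume.restrict (Ioo 0 a)] fun z : ℝ => z ^ (-(3:ℝ)/4) * (a - z) ^ ((1:ℝ)/2) *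
      (1 - z) ^ (-(3:ℝ)/4) * (b - z) ^ (-(1:ℝ)/4) := by
    filter_upwards [ae_restrict_mem measurableSet_Ioo] with z ⟨hz, hz'⟩
    have h2 : 0 < a - z := by linarith
    have h3 : 0 < 1 - z := by linarith
    have h4 : 0 < b - z := by linarith
    simp only [Pi.zero_apply]
    positivity
  have hle : (fun z : ℝ => z ^ (-(3:ℝ)/4) * (a - z) ^ ((1:ℝ)/2) *
      (1 - z) ^ (-(3:ℝ)/4) * (b - z) ^ (-(1:ℝ)/4)) ≤ᵐ[volume.restrict (Ioo 0 a)]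
      fun z => 2 * (b - 1) ^ (-(1:ℝ)/4) * a ^ ((1:ℝ)/2) * (z - 0) ^ (-(3:ℝ)/4) := by
    filter_upwards [ae_restrict_mem measurableSet_Ioo] with z ⟨hz, hz'⟩
    have h2 : 0 < a - z := by linarith
    have h3 : 0 < 1 - z := by linarith
    have h4 : 0 < b - z := by linarith
    have e1 : (a - z) ^ ((1:ℝ)/2) ≤ a ^ ((1:ℝ)/2) :=
      Real.rpow_le_rpow h2.le (by linarith) (by norm_num)
    have e2 : (1 - z) ^ (-(3:ℝ)/4) ≤ 2 :=
      rpow_neg_le_two (by linarith) (by norm_num) (by norm_num)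
    have e3 := Real.rpow_le_rpow_of_nonpos h5 (show b - 1 ≤ b - z by linarith)
      (show -(1:ℝ)/4 ≤ 0 by norm_num)
    calc _ ≤ z ^ (-(3:ℝ)/4) * a ^ ((1:ℝ)/2) * 2 * (b - 1) ^ (-(1:ℝ)/4) := by gcongr
      _ = _ := by rw [sub_zero]; ring
  constructor
  · refine (setIntegral_pos_iff_support_of_nonneg_ae hnn ((i0.const_mul
      (2 * (b - 1) ^ (-(1:ℝ)/4) * a ^ ((1:ℝ)/2))).mono'
      (Measurable.aestronglyMeasurable (by fun_prop)) ?_)).2 ?_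
    · filter_upwards [hnn, hle] with z h h'
      rwa [Real.norm_of_nonneg h]
    · have : Ioo 0 a ⊆ Function.support (fun z : ℝ => z ^ (-(3:ℝ)/4) * (a - z) ^ ((1:ℝ)/2) *
          (1 - z) ^ (-(3:ℝ)/4) * (b - z) ^ (-(1:ℝ)/4)) := by
        rintro z ⟨hz, hz'⟩
        have h2 : 0 < a - z := by linarith
        have h3 : 0 < 1 - z := by linarith
        have h4 : 0 < b - z := by linarith
        rw [Function.mem_support]
        positivity
      rw [inter_eq_right.2 this]
      simpa using ha
  · calc Q1 a b ≤ _ := integral_mono_of_nonneg hnn (i0.const_mul _) hle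
      _ = _ := by
        rw [integral_const_mul, setIntegral_sub_left_rpow _ _ ha.le, sub_zero]
        ring

lemma le_Q2 {a b : ℝ} (ha : 0 < a) (ha' : a < 1 / 4) (hb : 1 < b) :
    b ^ (-(3:ℝ)/4) * a ^ ((1:ℝ)/4) ≤ Q2 a b := by
  have h5 : 0 < b - 1 := by linarith
  have hint : IntegrableOn (fun z : ℝ => z ^ (-(1:ℝ)/4) * (a - z) ^ (-(1:ℝ)/2) *
      (1 - z) ^ (-(1:ℝ)/4) * (b - z) ^ (-(3:ℝ)/4)) (Ioo 0 a) := by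
    refine Integrable.mono' (((integrableOn_sub_left_rpow 0 a ha.le).add
      (integrableOn_sub_right_rpow 0 a ha.le)).mul_const (2 * (b - 1) ^ (-(3:ℝ)/4)))
      (Measurable.aestronglyMeasurable (by fun_prop)) ?_
    filter_upwards [ae_restrict_mem measurableSet_Ioo] with z ⟨hz, hz'⟩
    have h2 : 0 < a - z := by linarith
    have h3 : 0 < 1 - z := by linarith
    have h4 : 0 < b - z := by linarith
    rw [Real.norm_of_nonneg (by positivity)]
    have e2 : (1 - z) ^ (-(1:ℝ)/4) ≤ 2 :=
      rpow_neg_le_two (by linarith) (by norm_num) (by norm_num)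
    have e3 := Real.rpow_le_rpow_of_nonpos h5 (show b - 1 ≤ b - z by linarith)
      (show -(3:ℝ)/4 ≤ 0 by norm_num)
    calc _ ≤ (z ^ (-(3:ℝ)/4) + (a - z) ^ (-(3:ℝ)/4)) * 2 * (b - 1) ^ (-(3:ℝ)/4) := by
          gcongr
          exact rpow_mul_rpow_le_add hz h2
      _ = _ := by simp only [Pi.add_apply, sub_zero]; ring
  calc b ^ (-(3:ℝ)/4) * a ^ ((1:ℝ)/4)
      = ∫ _ in Ioo 0 a, a ^ (-(1:ℝ)/4) * a ^ (-(1:ℝ)/2) * 1 * b ^ (-(3:ℝ)/4) := by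
        have : a ^ ((1:ℝ)/4) = a ^ (1:ℝ) * (a ^ (-(1:ℝ)/4) * a ^ (-(1:ℝ)/2)) := by
          rw [← Real.rpow_add ha, ← Real.rpow_add ha]; norm_num
        rw [Real.rpow_one] at this
        rw [setIntegral_const, this]
        simp [ha.le]
        ring
    _ ≤ Q2 a b := by
        refine setIntegral_mono_on (integrableOn_const (by simp)) hint measurableSet_Ioo ?_
        rintro z ⟨hz, hz'⟩
        have h2 : 0 < a - z := by linarith
        have h3 : 0 < 1 - z := by linarith
        have h4 : 0 < b - z := by linarith
        have e1 := Real.rpow_le_rpow_of_nonpos hz hz'.le (show -(1:ℝ)/4 ≤ 0 by norm_num)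
        have e2 := Real.rpow_le_rpow_of_nonpos h2 (show a - z ≤ a by linarith)
          (show -(1:ℝ)/2 ≤ 0 by norm_num)
        have e3 := Real.one_le_rpow_of_pos_of_le_one_of_nonpos h3 (by linarith)
          (show -(1:ℝ)/4 ≤ 0 by norm_num)
        have e4 := Real.rpow_le_rpow_of_nonpos h4 (show b - z ≤ b by linarith)
          (show -(3:ℝ)/4 ≤ 0 by norm_num)
        gcongr

theorem ss4_ratio_comparison_near_zero :
    ∀ b : ℝ, 1 < b → ∃ δ : ℝ, δ ∈ Ioo (0:ℝ) 1 ∧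
      ∀ a ∈ Ioo (0:ℝ) δ,
        P1 a b / Q1 a b > P2 a b / Q2 a b := by
  intro b hb
  have hb0 : 0 < b := by linarith
  have hb1 : 0 < b - 1 := by linarith
  set k₁ := b ^ (-(1:ℝ)/4) / 8 with hk₁
  set k₂ := 16 * (b - 1) ^ (-(3:ℝ)/4) with hk₂
  set k₃ := 8 * (b - 1) ^ (-(1:ℝ)/4) with hk₃
  set k₄ := b ^ (-(3:ℝ)/4) with hk₄
  have p₁ : 0 < k₁ := by positivity
  have p₂ : 0 < k₂ := by positivity
  have p₃ : 0 < k₃ := by positivity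
  have p₄ : 0 < k₄ := by positivity
  refine ⟨min (1/4) ((k₁ * k₄ / (k₂ * k₃)) ^ 2),
    ⟨by positivity, (min_le_left _ _).trans_lt (by norm_num)⟩, ?_⟩
  rintro a ⟨ha, haδ⟩
  have ha' : a < 1 / 4 := haδ.trans_le (min_le_left _ _)
  obtain ⟨hQ1, hQ1'⟩ := Q1_bounds ha ha' hb
  have hP1 := le_P1 ha ha' hb
  have hP2 := P2_le ha ha' hb
  have hQ2 := le_Q2 ha ha' hb
  rw [← hk₃] at hQ1'
  rw [← hk₁] at hP1
  rw [← hk₂] at hP2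
  rw [← hk₄] at hQ2
  have hr : 0 < a ^ ((1:ℝ)/4) := by positivity
  have hs : a ^ ((1:ℝ)/2) < k₁ * k₄ / (k₂ * k₃) := by
    rw [← Real.sqrt_eq_rpow]
    exact (Real.sqrt_lt' (by positivity)).2 (haδ.trans_le (min_le_right _ _))
  rw [lt_div_iff₀ (by positivity)] at hs
  have hQ2pos : 0 < Q2 a b := (by positivity : 0 < k₄ * a ^ ((1:ℝ)/4)).trans_le hQ2
  have hP1pos : 0 < P1 a b := p₁.trans_le hP1
  rw [gt_iff_lt, div_lt_div_iff₀ hQ2pos hQ1]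
  calc P2 a b * Q1 a b ≤ k₂ * (k₃ * (a ^ ((1:ℝ)/4) * a ^ ((1:ℝ)/2))) := by gcongr
    _ = a ^ ((1:ℝ)/4) * (a ^ ((1:ℝ)/2) * (k₂ * k₃)) := by ring
    _ < a ^ ((1:ℝ)/4) * (k₁ * k₄) := by gcongr
    _ = k₁ * (k₄ * a ^ ((1:ℝ)/4)) := by ring
    _ ≤ P1 a b * Q2 a b := by gcongr
end

section
/- For each fixed real b > 1 there exists δ ∈ (0,1) such that for all a ∈ (1-δ,1): P₁(a,b)/Q₁(a,b) < P₂(a,b)/Q₂(a,b). (The other side of the intermediate-value argument for the SS-4 period problem, near a = 1.) -/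
open MeasureTheory Set

lemma integrableOn_sub_left_rpow_s6 {l u r : ℝ} (hlu : l < u) (hr : -1 < r) :
    IntegrableOn (fun z => (z - l) ^ r) (Ioo l u) := by
  rw [← intervalIntegrable_iff_integrableOn_Ioo_of_le hlu.le]
  have h := (intervalIntegral.intervalIntegrable_rpow' (a := 0) (b := u - l) hr).comp_sub_right l
  simpa using h

lemma integrableOn_sub_right_rpow_s6 {l u r : ℝ} (hlu : l < u) (hr : -1 < r) :
    IntegrableOn (fun z => (u - z) ^ r) (Ioo l u) := by
  rw [← intervalIntegrable_iff_integrableOn_Ioo_of_le hlu.le]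
  have h := (intervalIntegral.intervalIntegrable_rpow' (a := u - l) (b := 0) hr).comp_sub_left u
  simpa using h

lemma setIntegral_sub_left_rpow_s6 {l u r : ℝ} (hlu : l < u) (hr : -1 < r) :
    ∫ z in Ioo l u, (z - l) ^ r = (u - l) ^ (r + 1) / (r + 1) := by
  rw [← integral_Ioc_eq_integral_Ioo, ← intervalIntegral.integral_of_le hlu.le,
    intervalIntegral.integral_comp_sub_right (fun x => x ^ r), integral_rpow (Or.inl hr),
    sub_self, Real.zero_rpow (by linarith), sub_zero]

lemma setIntegral_sub_right_rpow_s6 {l u r : ℝ} (hlu : l < u) (hr : -1 < r) :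
    ∫ z in Ioo l u, (u - z) ^ r = (u - l) ^ (r + 1) / (r + 1) := by
  rw [← integral_Ioc_eq_integral_Ioo, ← intervalIntegral.integral_of_le hlu.le,
    intervalIntegral.integral_comp_sub_left (fun x => x ^ r), integral_rpow (Or.inl hr),
    sub_self, Real.zero_rpow (by linarith), sub_zero]

lemma rpow_mul_rpow_le {x y c r s : ℝ} (hx : 0 < x) (hy : 0 < y) (hc : 0 < c)
    (hxy : 2 * c ≤ x + y) (hr : r ≤ 0) (hs : s ≤ 0) :
    x ^ r * y ^ s ≤ c ^ s * x ^ r + c ^ r * y ^ s := by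
  have hxr := Real.rpow_nonneg hx.le r
  have hys := Real.rpow_nonneg hy.le s
  have hcr := Real.rpow_nonneg hc.le r
  have hcs := Real.rpow_nonneg hc.le s
  rcases le_total c x with h | h
  · have := mul_le_mul_of_nonneg_right (Real.rpow_le_rpow_of_nonpos hc h hr) hys
    nlinarith [mul_nonneg hcs hxr]
  · have := mul_le_mul_of_nonneg_right
      (Real.rpow_le_rpow_of_nonpos hc (by linarith : c ≤ y) hs) hxr
    nlinarith [mul_nonneg hcr hys]

lemma integrableOn_rpow_mul_rpow {l u r s : ℝ} (hlu : l < u) (hr : -1 < r) (hr0 : r ≤ 0)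
    (hs : -1 < s) (hs0 : s ≤ 0) :
    IntegrableOn (fun z => (z - l) ^ r * (u - z) ^ s) (Ioo l u) := by
  refine Integrable.mono' (((integrableOn_sub_left_rpow_s6 hlu hr).const_mul (((u - l) / 2) ^ s)).add
    ((integrableOn_sub_right_rpow_s6 hlu hs).const_mul (((u - l) / 2) ^ r)))
    (by fun_prop) ?_
  refine (ae_restrict_mem measurableSet_Ioo).mono fun z hz => ?_
  have h1 : 0 < z - l := sub_pos.2 hz.1
  have h2 : 0 < u - z := sub_pos.2 hz.2
  rw [Real.norm_of_nonneg (by positivity)]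
  exact rpow_mul_rpow_le h1 h2 (by linarith) (by linarith) hr0 hs0

lemma P1_le {a b : ℝ} (ha : 1 / 2 < a) (ha1 : a < 1) (hb : 1 < b) :
    P1 a b ≤ 8 * (b - 1) ^ (-(1:ℝ)/4) * (1 - a) ^ ((3:ℝ)/4) := by
  have hε : 0 < 1 - a := by linarith
  have hb1 : 0 < b - 1 := by linarith
  have hval := setIntegral_sub_right_rpow_s6 ha1 (r := -(3:ℝ)/4) (by norm_num)
  have hle : P1 a b ≤ ∫ z in Ioo a 1, (2 * (1 - a) ^ ((1:ℝ)/2) * (b - 1) ^ (-(1:ℝ)/4)) *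
      (1 - z) ^ (-(3:ℝ)/4) := by
    refine integral_mono_of_nonneg ?_
      ((integrableOn_sub_right_rpow_s6 ha1 (by norm_num)).const_mul _) ?_
    · refine (ae_restrict_mem measurableSet_Ioo).mono fun z hz => ?_
      have h0 : 0 < z := by linarith [hz.1]
      have h1 : 0 < z - a := sub_pos.2 hz.1
      have h2 : 0 < 1 - z := sub_pos.2 hz.2
      have h3 : 0 < b - z := by linarith
      simp only [Pi.zero_apply]
      positivity
    · refine (ae_restrict_mem measurableSet_Ioo).mono fun z hz => ?_
      have h0 : 0 < z := by linarith [hz.1]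
      have h1 : 0 < z - a := sub_pos.2 hz.1
      have h2 : 0 < 1 - z := sub_pos.2 hz.2
      have h3 : 0 < b - z := by linarith
      have e0 : z ^ (-(3:ℝ)/4) ≤ 2 := by
        calc z ^ (-(3:ℝ)/4) ≤ (1/2 : ℝ) ^ (-(3:ℝ)/4) :=
              Real.rpow_le_rpow_of_nonpos (by norm_num) (by linarith [hz.1]) (by norm_num)
          _ ≤ (1/2 : ℝ) ^ (-1 : ℝ) :=
              Real.rpow_le_rpow_of_exponent_ge (by norm_num) (by norm_num) (by norm_num)
          _ = 2 := by rw [Real.rpow_neg_one]; norm_num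
      have e1 : (z - a) ^ ((1:ℝ)/2) ≤ (1 - a) ^ ((1:ℝ)/2) :=
        Real.rpow_le_rpow h1.le (by linarith) (by norm_num)
      have e3 : (b - z) ^ (-(1:ℝ)/4) ≤ (b - 1) ^ (-(1:ℝ)/4) :=
        Real.rpow_le_rpow_of_nonpos hb1 (by linarith) (by norm_num)
      calc z ^ (-(3:ℝ)/4) * (z - a) ^ ((1:ℝ)/2) * (1 - z) ^ (-(3:ℝ)/4) * (b - z) ^ (-(1:ℝ)/4)
          ≤ 2 * (1 - a) ^ ((1:ℝ)/2) * (1 - z) ^ (-(3:ℝ)/4) * (b - 1) ^ (-(1:ℝ)/4) := by gcongr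
        _ = _ := by ring
  rw [integral_const_mul, hval] at hle
  refine hle.trans_eq ?_
  have : (1 - a) ^ ((3:ℝ)/4) = (1 - a) ^ ((1:ℝ)/2) * (1 - a) ^ (-(3:ℝ)/4 + 1) := by
    rw [← Real.rpow_add hε]; norm_num
  rw [this]
  ring

lemma le_Q1 {a b : ℝ} (ha : 1 / 2 < a) (ha1 : a < 1) (hb : 1 < b) :
    1 / 8 * b ^ (-(1:ℝ)/4) ≤ Q1 a b := by
  have ha0 : 0 < a := by linarith
  have hε : 0 < 1 - a := by linarith
  have hb0 : 0 < b := by linarith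
  have hb1 : 0 < b - 1 := by linarith
  have hnonneg : ∀ z ∈ Ioo 0 a, 0 ≤ z ^ (-(3:ℝ)/4) * (a - z) ^ ((1:ℝ)/2) *
      (1 - z) ^ (-(3:ℝ)/4) * (b - z) ^ (-(1:ℝ)/4) := fun z hz => by
    have h0 : 0 < z := hz.1
    have h1 : 0 < a - z := sub_pos.2 hz.2
    have h2 : 0 < 1 - z := by linarith
    have h3 : 0 < b - z := by linarith
    positivity
  have hint : IntegrableOn (fun z : ℝ => z ^ (-(3:ℝ)/4) * (a - z) ^ ((1:ℝ)/2) *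
      (1 - z) ^ (-(3:ℝ)/4) * (b - z) ^ (-(1:ℝ)/4)) (Ioo 0 a) := by
    refine Integrable.mono' ((integrableOn_sub_left_rpow_s6 ha0 (r := -(3:ℝ)/4) (by norm_num)).mul_const
      (1 * (1 - a) ^ (-(3:ℝ)/4) * (b - 1) ^ (-(1:ℝ)/4))) (by fun_prop) ?_
    refine (ae_restrict_mem measurableSet_Ioo).mono fun z hz => ?_
    rw [Real.norm_of_nonneg (hnonneg z hz), sub_zero]
    have h0 : 0 < z := hz.1
    have h1 : 0 < a - z := sub_pos.2 hz.2
    have h2 : 0 < 1 - z := by linarith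
    have h3 : 0 < b - z := by linarith
    have e1 : (a - z) ^ ((1:ℝ)/2) ≤ 1 := Real.rpow_le_one h1.le (by linarith) (by norm_num)
    have e2 : (1 - z) ^ (-(3:ℝ)/4) ≤ (1 - a) ^ (-(3:ℝ)/4) :=
      Real.rpow_le_rpow_of_nonpos hε (by linarith) (by norm_num)
    have e3 : (b - z) ^ (-(1:ℝ)/4) ≤ (b - 1) ^ (-(1:ℝ)/4) :=
      Real.rpow_le_rpow_of_nonpos hb1 (by linarith) (by norm_num)
    calc _ ≤ z ^ (-(3:ℝ)/4) * 1 * (1 - a) ^ (-(3:ℝ)/4) * (b - 1) ^ (-(1:ℝ)/4) := by gcongr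
      _ = _ := by ring
  have hsub : Ioo (0:ℝ) (1/4) ⊆ Ioo 0 a := Ioo_subset_Ioo_right (by linarith)
  calc 1 / 8 * b ^ (-(1:ℝ)/4) = ∫ _ in Ioo (0:ℝ) (1/4), 1 * (1/2) * 1 * b ^ (-(1:ℝ)/4) := by
        rw [setIntegral_const, Measure.real, Real.volume_Ioo,
          ENNReal.toReal_ofReal (by norm_num), smul_eq_mul]
        ring
    _ ≤ ∫ z in Ioo (0:ℝ) (1/4), z ^ (-(3:ℝ)/4) * (a - z) ^ ((1:ℝ)/2) *
      (1 - z) ^ (-(3:ℝ)/4) * (b - z) ^ (-(1:ℝ)/4) := by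
        refine setIntegral_mono_on (integrableOn_const (by simp)) (hint.mono_set hsub)
          measurableSet_Ioo fun z hz => ?_
        have h0 : 0 < z := hz.1
        have h0' : z < 1 / 4 := hz.2
        have h1 : 0 < a - z := by linarith
        have h2 : 0 < 1 - z := by linarith
        have h3 : 0 < b - z := by linarith
        have e0 : 1 ≤ z ^ (-(3:ℝ)/4) :=
          Real.one_le_rpow_of_pos_of_le_one_of_nonpos h0 (by linarith) (by norm_num)
        have e1 : 1 / 2 ≤ (a - z) ^ ((1:ℝ)/2) := by
          rw [← Real.sqrt_eq_rpow]
          exact Real.le_sqrt_of_sq_le (by linarith)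
        have e2 : 1 ≤ (1 - z) ^ (-(3:ℝ)/4) :=
          Real.one_le_rpow_of_pos_of_le_one_of_nonpos h2 (by linarith) (by norm_num)
        have e3 : b ^ (-(1:ℝ)/4) ≤ (b - z) ^ (-(1:ℝ)/4) :=
          Real.rpow_le_rpow_of_nonpos h3 (by linarith) (by norm_num)
        gcongr
    _ ≤ Q1 a b := setIntegral_mono_set hint
        ((ae_restrict_mem measurableSet_Ioo).mono hnonneg) hsub.eventuallyLE

lemma le_P2 {a b : ℝ} (ha : 0 < a) (ha1 : a < 1) (hb : 1 < b) :
    b ^ (-(3:ℝ)/4) * (1 - a) ^ ((1:ℝ)/4) ≤ P2 a b := by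
  have hε : 0 < 1 - a := by linarith
  have hb0 : 0 < b := by linarith
  have hb1 : 0 < b - 1 := by linarith
  have hint : IntegrableOn (fun z : ℝ => z ^ (-(1:ℝ)/4) * (z - a) ^ (-(1:ℝ)/2) *
      (1 - z) ^ (-(1:ℝ)/4) * (b - z) ^ (-(3:ℝ)/4)) (Ioo a 1) := by
    refine Integrable.mono' ((integrableOn_rpow_mul_rpow ha1 (r := -(1:ℝ)/2) (s := -(1:ℝ)/4)
      (by norm_num) (by norm_num) (by norm_num) (by norm_num)).mul_const
      (a ^ (-(1:ℝ)/4) * (b - 1) ^ (-(3:ℝ)/4))) (by fun_prop) ?_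
    refine (ae_restrict_mem measurableSet_Ioo).mono fun z hz => ?_
    have h0 : 0 < z := by linarith [hz.1]
    have h1 : 0 < z - a := sub_pos.2 hz.1
    have h2 : 0 < 1 - z := sub_pos.2 hz.2
    have h3 : 0 < b - z := by linarith
    rw [Real.norm_of_nonneg (by positivity)]
    have e0 : z ^ (-(1:ℝ)/4) ≤ a ^ (-(1:ℝ)/4) :=
      Real.rpow_le_rpow_of_nonpos ha hz.1.le (by norm_num)
    have e3 : (b - z) ^ (-(3:ℝ)/4) ≤ (b - 1) ^ (-(3:ℝ)/4) :=
      Real.rpow_le_rpow_of_nonpos hb1 (by linarith) (by norm_num)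
    calc _ ≤ a ^ (-(1:ℝ)/4) * (z - a) ^ (-(1:ℝ)/2) *
          (1 - z) ^ (-(1:ℝ)/4) * (b - 1) ^ (-(3:ℝ)/4) := by gcongr
      _ = _ := by ring
  calc b ^ (-(3:ℝ)/4) * (1 - a) ^ ((1:ℝ)/4)
      = ∫ _ in Ioo a 1, 1 * (1 - a) ^ (-(1:ℝ)/2) * (1 - a) ^ (-(1:ℝ)/4) * b ^ (-(3:ℝ)/4) := by
        rw [setIntegral_const, Measure.real, Real.volume_Ioo,
          ENNReal.toReal_ofReal hε.le, smul_eq_mul]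
        have : (1 - a) ^ ((1:ℝ)/4) =
            (1 - a) ^ (1:ℝ) * (1 - a) ^ (-(1:ℝ)/2) * (1 - a) ^ (-(1:ℝ)/4) := by
          rw [← Real.rpow_add hε, ← Real.rpow_add hε]; norm_num
        rw [this, Real.rpow_one]
        ring
    _ ≤ P2 a b := by
        refine setIntegral_mono_on (integrableOn_const (by simp)) hint
          measurableSet_Ioo fun z hz => ?_
        have h0 : 0 < z := by linarith [hz.1]
        have h1 : 0 < z - a := sub_pos.2 hz.1
        have h2 : 0 < 1 - z := sub_pos.2 hz.2
        have h3 : 0 < b - z := by linarith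
        have e0 : 1 ≤ z ^ (-(1:ℝ)/4) :=
          Real.one_le_rpow_of_pos_of_le_one_of_nonpos h0 (by linarith) (by norm_num)
        have e1 : (1 - a) ^ (-(1:ℝ)/2) ≤ (z - a) ^ (-(1:ℝ)/2) :=
          Real.rpow_le_rpow_of_nonpos h1 (by linarith) (by norm_num)
        have e2 : (1 - a) ^ (-(1:ℝ)/4) ≤ (1 - z) ^ (-(1:ℝ)/4) :=
          Real.rpow_le_rpow_of_nonpos h2 (by linarith [hz.1]) (by norm_num)
        have e3 : b ^ (-(3:ℝ)/4) ≤ (b - z) ^ (-(3:ℝ)/4) :=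
          Real.rpow_le_rpow_of_nonpos h3 (by linarith) (by norm_num)
        gcongr

lemma Q2_pos_and_le {a b : ℝ} (ha : 1 / 2 < a) (ha1 : a < 1) (hb : 1 < b) :
    0 < Q2 a b ∧ Q2 a b ≤ 32 * (b - 1) ^ (-(3:ℝ)/4) := by
  have ha0 : 0 < a := by linarith
  have hb0 : 0 < b := by linarith
  have hb1 : 0 < b - 1 := by linarith
  have hpos : ∀ z ∈ Ioo 0 a, 0 < z ^ (-(1:ℝ)/4) * (a - z) ^ (-(1:ℝ)/2) *
      (1 - z) ^ (-(1:ℝ)/4) * (b - z) ^ (-(3:ℝ)/4) := fun z hz => by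
    have h0 : 0 < z := hz.1
    have h1 : 0 < a - z := sub_pos.2 hz.2
    have h2 : 0 < 1 - z := by linarith
    have h3 : 0 < b - z := by linarith
    positivity
  have quarter : ∀ r : ℝ, -1 ≤ r → (1/4 : ℝ) ^ r ≤ 4 := fun r hr => by
    calc (1/4 : ℝ) ^ r ≤ (1/4 : ℝ) ^ (-1 : ℝ) :=
          Real.rpow_le_rpow_of_exponent_ge (by norm_num) (by norm_num) hr
      _ = 4 := by rw [Real.rpow_neg_one]; norm_num
  have hbound : ∀ z ∈ Ioo 0 a, z ^ (-(1:ℝ)/4) * (a - z) ^ (-(1:ℝ)/2) *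
      (1 - z) ^ (-(1:ℝ)/4) * (b - z) ^ (-(3:ℝ)/4) ≤
      4 * (b - 1) ^ (-(3:ℝ)/4) * ((z - 0) ^ (-(1:ℝ)/4) + (a - z) ^ (-(3:ℝ)/4)) := fun z hz => by
    have h0 : 0 < z := hz.1
    have h1 : 0 < a - z := sub_pos.2 hz.2
    have h2 : 0 < 1 - z := by linarith
    have h3 : 0 < b - z := by linarith
    have e2 : (1 - z) ^ (-(1:ℝ)/4) ≤ (a - z) ^ (-(1:ℝ)/4) :=
      Real.rpow_le_rpow_of_nonpos h1 (by linarith) (by norm_num)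
    have e3 : (b - z) ^ (-(3:ℝ)/4) ≤ (b - 1) ^ (-(3:ℝ)/4) :=
      Real.rpow_le_rpow_of_nonpos hb1 (by linarith) (by norm_num)
    have e4 : (a - z) ^ (-(3:ℝ)/4) = (a - z) ^ (-(1:ℝ)/2) * (a - z) ^ (-(1:ℝ)/4) := by
      rw [← Real.rpow_add h1]; norm_num
    have e5 := rpow_mul_rpow_le (c := 1/4) (r := -(1:ℝ)/4) (s := -(3:ℝ)/4) h0 h1 (by norm_num)
      (by linarith) (by norm_num) (by norm_num)
    have e6 := quarter (-(1:ℝ)/4) (by norm_num)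
    have e7 := quarter (-(3:ℝ)/4) (by norm_num)
    rw [sub_zero]
    calc _ ≤ z ^ (-(1:ℝ)/4) * (a - z) ^ (-(1:ℝ)/2) *
          (a - z) ^ (-(1:ℝ)/4) * (b - 1) ^ (-(3:ℝ)/4) := by gcongr
      _ = (z ^ (-(1:ℝ)/4) * (a - z) ^ (-(3:ℝ)/4)) * (b - 1) ^ (-(3:ℝ)/4) := by rw [e4]; ring
      _ ≤ (4 * z ^ (-(1:ℝ)/4) + 4 * (a - z) ^ (-(3:ℝ)/4)) * (b - 1) ^ (-(3:ℝ)/4) := by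
          refine mul_le_mul_of_nonneg_right (e5.trans ?_) (by positivity)
          gcongr
      _ = _ := by ring
  have hl := integrableOn_sub_left_rpow_s6 ha0 (r := -(1:ℝ)/4) (by norm_num)
  have hr := integrableOn_sub_right_rpow_s6 ha0 (r := -(3:ℝ)/4) (by norm_num)
  have hdom := (hl.add hr).const_mul (4 * (b - 1) ^ (-(3:ℝ)/4))
  have hint : IntegrableOn (fun z : ℝ => z ^ (-(1:ℝ)/4) * (a - z) ^ (-(1:ℝ)/2) *
      (1 - z) ^ (-(1:ℝ)/4) * (b - z) ^ (-(3:ℝ)/4)) (Ioo 0 a) := by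
    refine Integrable.mono' hdom (by fun_prop) ?_
    refine (ae_restrict_mem measurableSet_Ioo).mono fun z hz => ?_
    rw [Real.norm_of_nonneg (hpos z hz).le]
    exact hbound z hz
  constructor
  · unfold Q2
    rw [setIntegral_pos_iff_support_of_nonneg_ae
      ((ae_restrict_mem measurableSet_Ioo).mono fun z hz => (hpos z hz).le) hint,
      inter_eq_right.2 fun z hz => Function.mem_support.2 (hpos z hz).ne', Real.volume_Ioo]
    simpa using ha0
  · have hle : Q2 a b ≤ _ := setIntegral_mono_on hint hdom measurableSet_Ioo hbound
    refine hle.trans ?_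
    have h1 : a ^ (-(1:ℝ)/4 + 1) ≤ 1 := Real.rpow_le_one ha0.le ha1.le (by norm_num)
    have h2 : a ^ (-(3:ℝ)/4 + 1) ≤ 1 := Real.rpow_le_one ha0.le ha1.le (by norm_num)
    rw [integral_const_mul]
    simp only [Pi.add_apply]
    rw [integral_add hl hr, setIntegral_sub_left_rpow_s6 ha0 (by norm_num),
      setIntegral_sub_right_rpow_s6 ha0 (by norm_num), sub_zero]
    have hB : 0 < (b - 1) ^ (-(3:ℝ)/4) := by positivity
    have h3 : a ^ (-(1:ℝ)/4 + 1) / (-(1:ℝ)/4 + 1) + a ^ (-(3:ℝ)/4 + 1) / (-(3:ℝ)/4 + 1) ≤ 8 := by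
      norm_num at h1 h2 ⊢
      linarith
    nlinarith

theorem ss4_ratio_comparison_near_one :
    ∀ b : ℝ, 1 < b → ∃ δ : ℝ, δ ∈ Ioo (0:ℝ) 1 ∧
      ∀ a ∈ Ioo (1 - δ) 1,
        P1 a b / Q1 a b < P2 a b / Q2 a b := by
  intro b hb
  have hb0 : 0 < b := by linarith
  have hb1 : 0 < b - 1 := by linarith
  set C₁ := 8 * (b - 1) ^ (-(1:ℝ)/4) with hC₁
  set C₂ := 1 / 8 * b ^ (-(1:ℝ)/4) with hC₂
  set C₃ := b ^ (-(3:ℝ)/4) with hC₃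
  set C₄ := 32 * (b - 1) ^ (-(3:ℝ)/4) with hC₄
  have p1 : 0 < C₁ := by positivity
  have p2 : 0 < C₂ := by positivity
  have p3 : 0 < C₃ := by positivity
  have p4 : 0 < C₄ := by positivity
  set K := C₃ * C₂ / (C₁ * C₄) with hK
  have hKpos : 0 < K := by positivity
  refine ⟨min (1/2) (K ^ 2), ⟨by positivity, (min_le_left _ _).trans_lt (by norm_num)⟩, ?_⟩
  rintro a ⟨ha, ha1⟩
  have hε : 0 < 1 - a := by linarith
  have hd1 : 1 / 2 < a := by linarith [min_le_left (1/2) (K ^ 2)]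
  have hd2 : 1 - a < K ^ 2 := by linarith [min_le_right (1/2) (K ^ 2)]
  have hsqrt : (1 - a) ^ ((1:ℝ)/2) < K := by
    rw [← Real.sqrt_eq_rpow]
    exact (Real.sqrt_lt' hKpos).2 hd2
  obtain ⟨hQ2, hQ2le⟩ := Q2_pos_and_le hd1 ha1 hb
  have hsplit : (1 - a) ^ ((3:ℝ)/4) = (1 - a) ^ ((1:ℝ)/2) * (1 - a) ^ ((1:ℝ)/4) := by
    rw [← Real.rpow_add hε]; norm_num
  have hq : 0 < (1 - a) ^ ((1:ℝ)/4) := by positivity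
  calc P1 a b / Q1 a b ≤ C₁ * (1 - a) ^ ((3:ℝ)/4) / C₂ :=
        div_le_div₀ (by positivity) (P1_le hd1 ha1 hb) p2 (le_Q1 hd1 ha1 hb)
    _ = (C₁ / C₂ * (1 - a) ^ ((1:ℝ)/4)) * (1 - a) ^ ((1:ℝ)/2) := by rw [hsplit]; ring
    _ < (C₁ / C₂ * (1 - a) ^ ((1:ℝ)/4)) * K := mul_lt_mul_of_pos_left hsqrt (by positivity)
    _ = C₃ * (1 - a) ^ ((1:ℝ)/4) / C₄ := by rw [hK]; field_simp
    _ ≤ P2 a b / Q2 a b :=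
        div_le_div₀ ((by positivity : 0 ≤ C₃ * (1 - a) ^ ((1:ℝ)/4)).trans
          (le_P2 (by linarith) ha1 hb)) (le_P2 (by linarith) ha1 hb) hQ2 hQ2le
end

section
/- For every real number a < 0 there exists a real number b with 0 < b < 1 such that (B₁(a,b) + C₁(a,b))/A₁(a,b) = (B₂(a,b) + C₂(a,b))/A₂(a,b). (Solvability of the one-dimensional period problem for the CS-4 family of triply periodic minimal surfaces.) -/
open MeasureTheory Set

/-- A₁(a,b) = ∫_a^0 (z-a)^{1/2}(-z)^{-3/4}(b-z)^{-3/4}(1-z)^{-3/4} dz -/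
noncomputable def A1 (a b : ℝ) : ℝ :=
  ∫ z in Ioo a 0, (z - a) ^ ((1:ℝ)/2) * (-z) ^ (-(3:ℝ)/4) * (b - z) ^ (-(3:ℝ)/4) * (1 - z) ^ (-(3:ℝ)/4)

/-- B₁(a,b) = ∫_{-∞}^a (a-z)^{1/2}(-z)^{-3/4}(b-z)^{-3/4}(1-z)^{-3/4} dz -/
noncomputable def B1 (a b : ℝ) : ℝ :=
  ∫ z in Iio a, (a - z) ^ ((1:ℝ)/2) * (-z) ^ (-(3:ℝ)/4) * (b - z) ^ (-(3:ℝ)/4) * (1 - z) ^ (-(3:ℝ)/4)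

/-- C₁(a,b) = ∫_b^1 (z-a)^{1/2} z^{-3/4}(z-b)^{-3/4}(1-z)^{-3/4} dz -/
noncomputable def C1 (a b : ℝ) : ℝ :=
  ∫ z in Ioo b 1, (z - a) ^ ((1:ℝ)/2) * z ^ (-(3:ℝ)/4) * (z - b) ^ (-(3:ℝ)/4) * (1 - z) ^ (-(3:ℝ)/4)

/-- A₂(a,b) = ∫_a^0 (z-a)^{-1/2}(-z)^{-1/4}(b-z)^{-1/4}(1-z)^{-1/4} dz -/
noncomputable def A2 (a b : ℝ) : ℝ :=
  ∫ z in Ioo a 0, (z - a) ^ (-(1:ℝ)/2) * (-z) ^ (-(1:ℝ)/4) * (b - z) ^ (-(1:ℝ)/4) * (1 - z) ^ (-(1:ℝ)/4)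

/-- B₂(a,b) = ∫_{-∞}^a (a-z)^{-1/2}(-z)^{-1/4}(b-z)^{-1/4}(1-z)^{-1/4} dz -/
noncomputable def B2 (a b : ℝ) : ℝ :=
  ∫ z in Iio a, (a - z) ^ (-(1:ℝ)/2) * (-z) ^ (-(1:ℝ)/4) * (b - z) ^ (-(1:ℝ)/4) * (1 - z) ^ (-(1:ℝ)/4)

/-- C₂(a,b) = ∫_b^1 (z-a)^{-1/2} z^{-1/4}(z-b)^{-1/4}(1-z)^{-1/4} dz -/
noncomputable def C2 (a b : ℝ) : ℝ :=
  ∫ z in Ioo b 1, (z - a) ^ (-(1:ℝ)/2) * z ^ (-(1:ℝ)/4) * (z - b) ^ (-(1:ℝ)/4) * (1 - z) ^ (-(1:ℝ)/4)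
/-- The weight `x ^ p * (c - x) ^ q` is integrable on `(0, c)` for exponents above `-1`. -/
lemma integrableOn_betaWeight {p q c : ℝ} (hp : -1 < p) (hq : -1 < q) (hc : 0 < c) :
    IntegrableOn (fun x : ℝ => x ^ p * (c - x) ^ q) (Ioo 0 c) := by
  have left : ∀ {p : ℝ} (q : ℝ), -1 < p →
      IntervalIntegrable (fun x : ℝ => x ^ p * (c - x) ^ q) volume 0 (c / 2) := by
    intro p q hp
    apply IntervalIntegrable.mul_continuousOn (intervalIntegral.intervalIntegrable_rpow' hp)
    intro x hx
    rw [uIcc_of_le (by positivity)] at hx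
    exact (ContinuousAt.rpow (by fun_prop) (by fun_prop)
      (Or.inl (by linarith [hx.2]))).continuousWithinAt
  have right : IntervalIntegrable (fun x : ℝ => x ^ p * (c - x) ^ q) volume (c / 2) c := by
    have h := ((left p hq).comp_sub_left c).symm
    convert! h using 1
    · ext x
      rw [sub_sub_cancel, mul_comm]
    · ring
    · ring
  have h := (left q hp).trans right
  rwa [intervalIntegrable_iff_integrableOn_Ioo_of_le hc.le] at h

lemma integrableOn_betaWeight_mul {p q c : ℝ} (hp : -1 < p) (hq : -1 < q) (hc : 0 < c)
    {φ : ℝ → ℝ} (hφ : ContinuousOn φ (Icc 0 c)) :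
    IntegrableOn (fun x : ℝ => x ^ p * (c - x) ^ q * φ x) (Ioo 0 c) :=
  (integrableOn_betaWeight hp hq hc).mul_continuousOn_of_subset hφ measurableSet_Ioo
    isCompact_Icc Ioo_subset_Icc_self

lemma continuousOn_integral_betaWeight_mul {p q c l r : ℝ} (hp : -1 < p) (hq : -1 < q)
    (hc : 0 < c) {φ : ℝ → ℝ → ℝ}
    (hφ : ContinuousOn (fun y : ℝ × ℝ => φ y.1 y.2) (Icc l r ×ˢ Icc 0 c)) :
    ContinuousOn (fun b => ∫ x in Ioo 0 c, x ^ p * (c - x) ^ q * φ b x) (Icc l r) := by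
  obtain ⟨M, hM⟩ := (isCompact_Icc.prod isCompact_Icc).exists_bound_of_continuousOn hφ
  have hb : ∀ b ∈ Icc l r, ContinuousOn (φ b) (Icc 0 c) := fun b hb =>
    hφ.comp (f := fun x => (b, x)) (by fun_prop) fun x hx => ⟨hb, hx⟩
  refine MeasureTheory.continuousOn_of_dominated
    (bound := fun x => ‖x ^ p * (c - x) ^ q‖ * M) ?_ ?_ ?_ ?_
  · exact fun b h => (integrableOn_betaWeight_mul hp hq hc (hb b h)).aestronglyMeasurable
  · refine fun b h => (ae_restrict_mem measurableSet_Ioo).mono fun x hx => ?_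
    rw [norm_mul]
    gcongr
    exact hM (b, x) ⟨h, Ioo_subset_Icc_self hx⟩
  · exact (integrableOn_betaWeight hp hq hc).norm.mul_const M
  · refine (ae_restrict_mem measurableSet_Ioo).mono fun x hx => ?_
    exact continuousOn_const.mul (hφ.comp (f := fun b => (b, x)) (by fun_prop)
      fun b hb => ⟨hb, Ioo_subset_Icc_self hx⟩)

lemma setIntegral_Ioo_pos {f : ℝ → ℝ} {c : ℝ} (hc : 0 < c) (hf : IntegrableOn f (Ioo 0 c))
    (hpos : ∀ x ∈ Ioo 0 c, 0 < f x) : 0 < ∫ x in Ioo 0 c, f x := by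
  have h := intervalIntegral.intervalIntegral_pos_of_pos_on
    ((intervalIntegrable_iff_integrableOn_Ioo_of_le hc.le).2 hf) hpos hc
  rwa [intervalIntegral.integral_of_le hc.le, integral_Ioc_eq_integral_Ioo] at h

lemma setIntegral_Ioo_neg (g : ℝ → ℝ) (α : ℝ) :
    ∫ z in Ioo (-α) 0, g z = ∫ x in Ioo 0 α, g (-x) := by
  have h := integral_image_eq_integral_abs_deriv_smul (f := fun x : ℝ => -x) (f' := fun _ => -1)
    (s := Ioo 0 α) measurableSet_Ioo (fun x _ => (hasDerivAt_neg x).hasDerivWithinAt)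
    neg_injective.injOn g
  simpa using h

lemma setIntegral_Iio_inversion (g : ℝ → ℝ) {α : ℝ} (hα : 0 < α) :
    ∫ z in Iio (-α), g z = ∫ u in Ioo 0 α, α ^ 2 / u ^ 2 * g (-(α ^ 2 / u)) := by
  have himg : (fun u : ℝ => -(α ^ 2 / u)) '' Ioo 0 α = Iio (-α) := by
    ext z
    simp only [mem_image, mem_Ioo, mem_Iio]
    constructor
    · rintro ⟨u, ⟨hu, hu'⟩, rfl⟩
      rw [neg_lt_neg_iff, lt_div_iff₀ hu]
      nlinarith
    · intro hz
      have hz' : 0 < -z := by linarith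
      refine ⟨α ^ 2 / -z, ⟨by positivity, ?_⟩, ?_⟩
      · rw [div_lt_iff₀ hz']
        nlinarith
      · field_simp
  have hinj : InjOn (fun u : ℝ => -(α ^ 2 / u)) (Ioo 0 α) := by
    intro u hu v hv h
    have hu' := hu.1.ne'
    have hv' := hv.1.ne'
    simp only [neg_inj] at h
    field_simp at h
    exact h.symm
  rw [← himg, integral_image_eq_integral_abs_deriv_smul (f' := fun u => α ^ 2 / u ^ 2)
    measurableSet_Ioo _ hinj]
  · refine setIntegral_congr_fun measurableSet_Ioo fun u hu => ?_
    simp only [smul_eq_mul]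
    rw [abs_of_nonneg (by positivity)]
  · intro u hu
    have h := ((hasDerivAt_inv hu.1.ne').const_mul (-α ^ 2)).hasDerivWithinAt (s := Ioo 0 α)
    convert! h using 1
    · ext x; rw [div_eq_mul_inv]; ring
    · field_simp

lemma setIntegral_Ioo_affine (g : ℝ → ℝ) {b : ℝ} (hb : b < 1) :
    ∫ z in Ioo b 1, g z = ∫ t in Ioo 0 1, (1 - b) * g (b + (1 - b) * t) := by
  have hb' : 0 < 1 - b := sub_pos.2 hb
  have himg : (fun t : ℝ => b + (1 - b) * t) '' Ioo 0 1 = Ioo b 1 := by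
    ext z
    simp only [mem_image, mem_Ioo]
    constructor
    · rintro ⟨t, ⟨ht, ht'⟩, rfl⟩
      constructor <;> nlinarith
    · rintro ⟨hz, hz'⟩
      refine ⟨(z - b) / (1 - b), ⟨div_pos (by linarith) hb', ?_⟩, ?_⟩
      · rw [div_lt_one hb']
        linarith
      · field_simp
        ring
  have hinj : InjOn (fun t : ℝ => b + (1 - b) * t) (Ioo 0 1) := by
    intro u _ v _ h
    simpa [hb'.ne'] using h
  rw [← himg, integral_image_eq_integral_abs_deriv_smul (f' := fun _ => 1 - b)
    measurableSet_Ioo _ hinj]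
  · simp only [smul_eq_mul, abs_of_pos hb']
  · intro u _
    simpa using (((hasDerivAt_id u).const_mul (1 - b)).const_add b).hasDerivWithinAt

lemma integral_Ioo_neg_kernel (p q α b : ℝ) :
    ∫ z in Ioo (-α) 0, (z - -α) ^ p * (-z) ^ q * (b - z) ^ q * (1 - z) ^ q =
      ∫ x in Ioo 0 α, x ^ q * (α - x) ^ p * ((b + x) ^ q * (1 + x) ^ q) := by
  rw [setIntegral_Ioo_neg]
  refine setIntegral_congr_fun measurableSet_Ioo fun x _ => ?_
  simp only [neg_neg, sub_neg_eq_add, neg_add_eq_sub]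
  ring

lemma log_add_sq_div {α b u : ℝ} (hα : 0 < α) (hb : 0 ≤ b) (hu : 0 < u) :
    Real.log (b + α ^ 2 / u) = Real.log (b * u + α ^ 2) - Real.log u := by
  rw [← Real.log_div (by positivity) hu.ne']
  congr 1
  field_simp

lemma integral_Iio_kernel (p q : ℝ) {α b : ℝ} (hα : 0 < α) (hb : 0 ≤ b) :
    ∫ z in Iio (-α), (-α - z) ^ p * (-z) ^ q * (b - z) ^ q * (1 - z) ^ q =
      ∫ u in Ioo 0 α, u ^ (-2 - p - 3 * q) * (α - u) ^ p *
        (α ^ (2 + p + 2 * q) * ((b * u + α ^ 2) ^ q * (1 * u + α ^ 2) ^ q)) := by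
  rw [setIntegral_Iio_inversion _ hα]
  refine setIntegral_congr_fun measurableSet_Ioo fun u ⟨hu, huα⟩ => ?_
  have h0 : 0 < α - u := by linarith
  have e1 : α ^ 2 / u - α = α * (α - u) / u := by field_simp
  have e2 : α ^ 2 / u ^ 2 = Real.exp (2 * Real.log α - 2 * Real.log u) := by
    rw [← Real.exp_log (show 0 < α ^ 2 / u ^ 2 by positivity),
      Real.log_div (by positivity) (by positivity), Real.log_pow, Real.log_pow]
    norm_cast
  simp only [neg_neg, sub_neg_eq_add, neg_add_eq_sub]
  rw [e1, e2, Real.rpow_def_of_pos (by positivity), Real.rpow_def_of_pos (by positivity),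
    Real.rpow_def_of_pos (by positivity), Real.rpow_def_of_pos (by positivity),
    Real.rpow_def_of_pos hu, Real.rpow_def_of_pos h0, Real.rpow_def_of_pos hα,
    Real.rpow_def_of_pos (by positivity), Real.rpow_def_of_pos (by positivity),
    log_add_sq_div hα hb hu, log_add_sq_div hα zero_le_one hu,
    Real.log_div (by positivity) hu.ne', Real.log_mul hα.ne' h0.ne',
    Real.log_div (by positivity) hu.ne', Real.log_pow]
  simp only [← Real.exp_add]
  congr 1
  push_cast
  ring

lemma integral_Ioo_one_kernel (p q α : ℝ) {b : ℝ} (hb : b < 1) :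
    ∫ z in Ioo b 1, (z - -α) ^ p * z ^ q * (z - b) ^ q * (1 - z) ^ q =
      (1 - b) ^ (1 + 2 * q) * ∫ t in Ioo 0 1, t ^ q * (1 - t) ^ q *
        ((b + (1 - b) * t + α) ^ p * (b + (1 - b) * t) ^ q) := by
  rw [setIntegral_Ioo_affine _ hb, ← integral_const_mul]
  refine setIntegral_congr_fun measurableSet_Ioo fun t ⟨ht, ht'⟩ => ?_
  have h1 : 0 < 1 - b := by linarith
  have h2 : 0 ≤ 1 - t := by linarith
  have e1 : b + (1 - b) * t - b = (1 - b) * t := by ring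
  have e2 : 1 - (b + (1 - b) * t) = (1 - b) * (1 - t) := by ring
  have e3 : (1 - b) ^ (1 + 2 * q) = (1 - b) * ((1 - b) ^ q * (1 - b) ^ q) := by
    rw [Real.rpow_add h1, Real.rpow_one, two_mul, Real.rpow_add h1]
  simp only [sub_neg_eq_add]
  rw [e1, e2, Real.mul_rpow h1.le ht.le, Real.mul_rpow h1.le h2, e3]
  ring

lemma A1_neg_eq (α b : ℝ) :
    A1 (-α) b = ∫ x in Ioo 0 α, x ^ (-(3:ℝ)/4) * (α - x) ^ ((1:ℝ)/2) *
      ((b + x) ^ (-(3:ℝ)/4) * (1 + x) ^ (-(3:ℝ)/4)) :=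
  integral_Ioo_neg_kernel _ _ α b

lemma A2_neg_eq (α b : ℝ) :
    A2 (-α) b = ∫ x in Ioo 0 α, x ^ (-(1:ℝ)/4) * (α - x) ^ (-(1:ℝ)/2) *
      ((b + x) ^ (-(1:ℝ)/4) * (1 + x) ^ (-(1:ℝ)/4)) :=
  integral_Ioo_neg_kernel _ _ α b

lemma B1_neg_eq {α b : ℝ} (hα : 0 < α) (hb : 0 ≤ b) :
    B1 (-α) b = ∫ u in Ioo 0 α, u ^ (-(1:ℝ)/4) * (α - u) ^ ((1:ℝ)/2) *
      (α * ((b * u + α ^ 2) ^ (-(3:ℝ)/4) * (1 * u + α ^ 2) ^ (-(3:ℝ)/4))) := by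
  rw [B1, integral_Iio_kernel _ _ hα hb,
    show (-2 - 1 / 2 - 3 * (-3 / 4) : ℝ) = -1 / 4 by norm_num,
    show (2 + 1 / 2 + 2 * (-3 / 4) : ℝ) = 1 by norm_num, Real.rpow_one]

lemma B2_neg_eq {α b : ℝ} (hα : 0 < α) (hb : 0 ≤ b) :
    B2 (-α) b = ∫ u in Ioo 0 α, u ^ (-(3:ℝ)/4) * (α - u) ^ (-(1:ℝ)/2) *
      (α * ((b * u + α ^ 2) ^ (-(1:ℝ)/4) * (1 * u + α ^ 2) ^ (-(1:ℝ)/4))) := by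
  rw [B2, integral_Iio_kernel _ _ hα hb,
    show (-2 - -1 / 2 - 3 * (-1 / 4) : ℝ) = -3 / 4 by norm_num,
    show (2 + -1 / 2 + 2 * (-1 / 4) : ℝ) = 1 by norm_num, Real.rpow_one]

/-- The integral `C₁(-α, b)` without its factor `(1 - b) ^ (-1/2)`. -/
noncomputable def C1Scaled (α b : ℝ) : ℝ :=
  ∫ t in Ioo 0 1, t ^ (-(3:ℝ)/4) * (1 - t) ^ (-(3:ℝ)/4) *
    ((b + (1 - b) * t + α) ^ ((1:ℝ)/2) * (b + (1 - b) * t) ^ (-(3:ℝ)/4))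

/-- The integral `C₂(-α, b)` without its factor `(1 - b) ^ (1/2)`. -/
noncomputable def C2Scaled (α b : ℝ) : ℝ :=
  ∫ t in Ioo 0 1, t ^ (-(1:ℝ)/4) * (1 - t) ^ (-(1:ℝ)/4) *
    ((b + (1 - b) * t + α) ^ (-(1:ℝ)/2) * (b + (1 - b) * t) ^ (-(1:ℝ)/4))

lemma C1_neg_eq (α : ℝ) {b : ℝ} (hb : b < 1) :
    C1 (-α) b = (1 - b) ^ (-(1:ℝ)/2) * C1Scaled α b := by
  rw [C1, integral_Ioo_one_kernel _ _ α hb, C1Scaled]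
  norm_num

lemma C2_neg_eq (α : ℝ) {b : ℝ} (hb : b < 1) :
    C2 (-α) b = (1 - b) ^ ((1:ℝ)/2) * C2Scaled α b := by
  rw [C2, integral_Ioo_one_kernel _ _ α hb, C2Scaled]
  norm_num

lemma affine_pos {b t : ℝ} (hb : 0 < b) (hb' : b ≤ 1) (ht : 0 ≤ t) : 0 < b + (1 - b) * t := by
  have := mul_nonneg (sub_nonneg.2 hb') ht
  linarith

lemma affine_le_one {b t : ℝ} (hb' : b ≤ 1) (ht : t ≤ 1) : b + (1 - b) * t ≤ 1 := by
  nlinarith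

lemma continuousOn_A1 {α l : ℝ} (hα : 0 < α) (hl : 0 < l) :
    ContinuousOn (A1 (-α)) (Icc l 1) := by
  simp only [funext (A1_neg_eq α)]
  refine continuousOn_integral_betaWeight_mul (by norm_num) (by norm_num) hα
    fun y ⟨hy, hx⟩ => ContinuousAt.continuousWithinAt ?_
  have h1 : y.1 + y.2 ≠ 0 := by linarith [hy.1, hx.1]
  have h2 : 1 + y.2 ≠ 0 := by linarith [hx.1]
  fun_prop (disch := simp [h1, h2])

lemma continuousOn_A2 {α l : ℝ} (hα : 0 < α) (hl : 0 < l) :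
    ContinuousOn (A2 (-α)) (Icc l 1) := by
  simp only [funext (A2_neg_eq α)]
  refine continuousOn_integral_betaWeight_mul (by norm_num) (by norm_num) hα
    fun y ⟨hy, hx⟩ => ContinuousAt.continuousWithinAt ?_
  have h1 : y.1 + y.2 ≠ 0 := by linarith [hy.1, hx.1]
  have h2 : 1 + y.2 ≠ 0 := by linarith [hx.1]
  fun_prop (disch := simp [h1, h2])

lemma continuousOn_B1 {α : ℝ} (hα : 0 < α) : ContinuousOn (B1 (-α)) (Icc 0 1) := by
  refine ContinuousOn.congr ?_ fun b hb => B1_neg_eq hα hb.1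
  refine continuousOn_integral_betaWeight_mul (φ := fun b u =>
    α * ((b * u + α ^ 2) ^ (-(3:ℝ)/4) * (1 * u + α ^ 2) ^ (-(3:ℝ)/4)))
    (by norm_num) (by norm_num) hα
    fun y ⟨hy, hx⟩ => ContinuousAt.continuousWithinAt ?_
  have h1 : y.1 * y.2 + α ^ 2 ≠ 0 := by have := mul_nonneg hy.1 hx.1; positivity
  have h2 : 1 * y.2 + α ^ 2 ≠ 0 := by have := hx.1; positivity
  fun_prop (disch := first | exact Or.inl h1 | exact Or.inl h2 | assumption)

lemma continuousOn_B2 {α : ℝ} (hα : 0 < α) : ContinuousOn (B2 (-α)) (Icc 0 1) := by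
  refine ContinuousOn.congr ?_ fun b hb => B2_neg_eq hα hb.1
  refine continuousOn_integral_betaWeight_mul (φ := fun b u =>
    α * ((b * u + α ^ 2) ^ (-(1:ℝ)/4) * (1 * u + α ^ 2) ^ (-(1:ℝ)/4)))
    (by norm_num) (by norm_num) hα
    fun y ⟨hy, hx⟩ => ContinuousAt.continuousWithinAt ?_
  have h1 : y.1 * y.2 + α ^ 2 ≠ 0 := by have := mul_nonneg hy.1 hx.1; positivity
  have h2 : 1 * y.2 + α ^ 2 ≠ 0 := by have := hx.1; positivity
  fun_prop (disch := first | exact Or.inl h1 | exact Or.inl h2 | assumption)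

lemma continuousOn_C1Scaled {α l : ℝ} (hα : 0 < α) (hl : 0 < l) :
    ContinuousOn (C1Scaled α) (Icc l 1) := by
  refine continuousOn_integral_betaWeight_mul (by norm_num) (by norm_num) one_pos
    fun y ⟨hy, hx⟩ => ContinuousAt.continuousWithinAt ?_
  have h := affine_pos (hl.trans_le hy.1) hy.2 hx.1
  have h1 : y.1 + (1 - y.1) * y.2 + α ≠ 0 := by positivity
  have h2 : y.1 + (1 - y.1) * y.2 ≠ 0 := h.ne'
  fun_prop (disch := first | exact Or.inl h1 | exact Or.inl h2 | assumption)

lemma continuousOn_C2Scaled {α l : ℝ} (hα : 0 < α) (hl : 0 < l) :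
    ContinuousOn (C2Scaled α) (Icc l 1) := by
  refine continuousOn_integral_betaWeight_mul (by norm_num) (by norm_num) one_pos
    fun y ⟨hy, hx⟩ => ContinuousAt.continuousWithinAt ?_
  have h := affine_pos (hl.trans_le hy.1) hy.2 hx.1
  have h1 : y.1 + (1 - y.1) * y.2 + α ≠ 0 := by positivity
  have h2 : y.1 + (1 - y.1) * y.2 ≠ 0 := h.ne'
  fun_prop (disch := first | exact Or.inl h1 | exact Or.inl h2 | assumption)

lemma integrableOn_A_kernel {p q α b : ℝ} (hp : -1 < p) (hq : -1 < q) (hα : 0 < α) (hb : 0 < b) :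
    IntegrableOn (fun x : ℝ => x ^ q * (α - x) ^ p * ((b + x) ^ q * (1 + x) ^ q)) (Ioo 0 α) := by
  refine integrableOn_betaWeight_mul hq hp hα fun x hx => ContinuousAt.continuousWithinAt ?_
  have h1 : b + x ≠ 0 := by linarith [hx.1]
  have h2 : 1 + x ≠ 0 := by linarith [hx.1]
  fun_prop (disch := first | exact Or.inl h1 | exact Or.inl h2 | assumption)

lemma integrableOn_B_kernel {p q α b : ℝ} (hp : -1 < p) (hq : -1 < q) (hα : 0 < α) (hb : 0 ≤ b)
    (r : ℝ) :
    IntegrableOn (fun u : ℝ => u ^ q * (α - u) ^ p *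
      (α * ((b * u + α ^ 2) ^ r * (1 * u + α ^ 2) ^ r))) (Ioo 0 α) := by
  refine integrableOn_betaWeight_mul hq hp hα fun u hu => ContinuousAt.continuousWithinAt ?_
  have h1 : b * u + α ^ 2 ≠ 0 := by have := mul_nonneg hb hu.1; positivity
  have h2 : 1 * u + α ^ 2 ≠ 0 := by have := hu.1; positivity
  fun_prop (disch := first | exact Or.inl h1 | exact Or.inl h2 | assumption)

lemma integrableOn_C_kernel {q α b : ℝ} (hq : -1 < q) (hα : 0 < α) (hb : 0 < b) (hb' : b ≤ 1)
    (p : ℝ) :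
    IntegrableOn (fun t : ℝ => t ^ q * (1 - t) ^ q *
      ((b + (1 - b) * t + α) ^ p * (b + (1 - b) * t) ^ q)) (Ioo 0 1) := by
  refine integrableOn_betaWeight_mul hq hq one_pos fun t ht => ContinuousAt.continuousWithinAt ?_
  have h := affine_pos hb hb' ht.1
  have h1 : b + (1 - b) * t + α ≠ 0 := by positivity
  have h2 : b + (1 - b) * t ≠ 0 := h.ne'
  fun_prop (disch := first | exact Or.inl h1 | exact Or.inl h2 | assumption)

lemma A1_pos {α b : ℝ} (hα : 0 < α) (hb : 0 < b) : 0 < A1 (-α) b := by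
  rw [A1_neg_eq]
  refine setIntegral_Ioo_pos hα (integrableOn_A_kernel (by norm_num) (by norm_num) hα hb)
    fun x ⟨hx, hx'⟩ => ?_
  have : 0 < α - x := by linarith
  positivity

lemma A2_pos {α b : ℝ} (hα : 0 < α) (hb : 0 < b) : 0 < A2 (-α) b := by
  rw [A2_neg_eq]
  refine setIntegral_Ioo_pos hα (integrableOn_A_kernel (by norm_num) (by norm_num) hα hb)
    fun x ⟨hx, hx'⟩ => ?_
  have : 0 < α - x := by linarith
  positivity

lemma C1Scaled_pos {α b : ℝ} (hα : 0 < α) (hb : 0 < b) (hb' : b ≤ 1) : 0 < C1Scaled α b := by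
  refine setIntegral_Ioo_pos one_pos (integrableOn_C_kernel (by norm_num) hα hb hb' _)
    fun t ⟨ht, ht'⟩ => ?_
  have : 0 < 1 - t := by linarith
  have := affine_pos hb hb' ht.le
  positivity

lemma rpow_mul_add_rpow_le {α b x : ℝ} (hb : 0 < b) (hx : 0 < x) (hx' : x < α) :
    x ^ ((1:ℝ)/4) * (b + x) ^ (-(1:ℝ)/4) ≤ α ^ ((1:ℝ)/2) * (b * x + α ^ 2) ^ (-(1:ℝ)/4) := by
  have hα : 0 < α := hx.trans hx'
  have e : α ^ ((1:ℝ)/2) = (α ^ 2) ^ ((1:ℝ)/4) := by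
    rw [← Real.rpow_natCast, ← Real.rpow_mul hα.le]
    norm_num
  rw [e, neg_div, Real.rpow_neg (by positivity), Real.rpow_neg (by positivity), ← div_eq_mul_inv,
    ← div_eq_mul_inv, ← Real.div_rpow (by positivity) (by positivity),
    ← Real.div_rpow (by positivity) (by positivity)]
  refine Real.rpow_le_rpow (by positivity) ?_ (by norm_num)
  rw [div_le_div_iff₀ (by positivity) (by positivity)]
  nlinarith [mul_pos hb (sub_pos.2 hx'), mul_pos (mul_pos hb (sub_pos.2 hx')) (add_pos hα hx)]

lemma A2_le_B2 {α b : ℝ} (hα : 0 < α) (hb : 0 < b) : A2 (-α) b ≤ B2 (-α) b := by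
  rw [A2_neg_eq, B2_neg_eq hα hb.le]
  refine setIntegral_mono_on (integrableOn_A_kernel (by norm_num) (by norm_num) hα hb)
    (integrableOn_B_kernel (by norm_num) (by norm_num) hα hb.le _) measurableSet_Ioo
    fun x ⟨hx, hx'⟩ => ?_
  have h1 := rpow_mul_add_rpow_le hb hx hx'
  have h2 := rpow_mul_add_rpow_le one_pos hx hx'
  have h3 : 0 < α - x := by linarith
  have e1 : x ^ (-(1:ℝ)/4) = x ^ (-(3:ℝ)/4) * (x ^ ((1:ℝ)/4) * x ^ ((1:ℝ)/4)) := by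
    rw [← Real.rpow_add hx, ← Real.rpow_add hx]
    norm_num
  have e2 : α = α ^ ((1:ℝ)/2) * α ^ ((1:ℝ)/2) := by
    rw [← Real.rpow_add hα]
    norm_num
  have h := mul_le_mul h1 h2 (by positivity) (by positivity)
  calc _ = x ^ (-(3:ℝ)/4) * (α - x) ^ (-(1:ℝ)/2) * (x ^ ((1:ℝ)/4) * (b + x) ^ (-(1:ℝ)/4) *
        (x ^ ((1:ℝ)/4) * (1 + x) ^ (-(1:ℝ)/4))) := by rw [e1]; ring
    _ ≤ x ^ (-(3:ℝ)/4) * (α - x) ^ (-(1:ℝ)/2) * _ := mul_le_mul_of_nonneg_left h (by positivity)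
    _ = x ^ (-(3:ℝ)/4) * (α - x) ^ (-(1:ℝ)/2) * (α ^ ((1:ℝ)/2) * α ^ ((1:ℝ)/2) *
        ((b * x + α ^ 2) ^ (-(1:ℝ)/4) * (1 * x + α ^ 2) ^ (-(1:ℝ)/4))) := by ring
    _ = _ := by rw [← e2]

lemma exists_mul_A2_le_C2 {α : ℝ} (hα : 0 < α) :
    ∃ c > 0, ∀ b, 0 < b → b ≤ 1 / 2 → c * A2 (-α) b ≤ C2 (-α) b := by
  have iV := integrableOn_betaWeight (p := -(1:ℝ)/2) (q := -(1:ℝ)/2)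
    (by norm_num) (by norm_num) hα
  have iW := integrableOn_betaWeight (p := -(1:ℝ)/4) (q := -(1:ℝ)/4)
    (by norm_num) (by norm_num) one_pos
  set V := ∫ x in Ioo 0 α, x ^ (-(1:ℝ)/2) * (α - x) ^ (-(1:ℝ)/2)
  set W := ∫ x in Ioo (0:ℝ) 1, x ^ (-(1:ℝ)/4) * (1 - x) ^ (-(1:ℝ)/4) with hWdef
  have hV : 0 < V := setIntegral_Ioo_pos hα iV fun x ⟨hx, hx'⟩ => by
    have : 0 < α - x := by linarith
    positivity
  have hW : 0 < W := setIntegral_Ioo_pos one_pos iW fun x ⟨hx, hx'⟩ => by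
    have : 0 < 1 - x := by linarith
    positivity
  have hA : ∀ b, 0 < b → A2 (-α) b ≤ V := by
    intro b hb
    rw [A2_neg_eq]
    refine setIntegral_mono_on (integrableOn_A_kernel (by norm_num) (by norm_num) hα hb) iV
      measurableSet_Ioo fun x ⟨hx, hx'⟩ => ?_
    have h3 : 0 < α - x := by linarith
    have h1 : (b + x) ^ (-(1:ℝ)/4) ≤ x ^ (-(1:ℝ)/4) :=
      Real.rpow_le_rpow_of_nonpos hx (by linarith) (by norm_num)
    have h2 : (1 + x) ^ (-(1:ℝ)/4) ≤ 1 :=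
      Real.rpow_le_one_of_one_le_of_nonpos (by linarith) (by norm_num)
    have e : x ^ (-(1:ℝ)/2) = x ^ (-(1:ℝ)/4) * x ^ (-(1:ℝ)/4) := by
      rw [← Real.rpow_add hx]
      norm_num
    calc _ ≤ x ^ (-(1:ℝ)/4) * (α - x) ^ (-(1:ℝ)/2) * (x ^ (-(1:ℝ)/4) * 1) := by gcongr
      _ = _ := by rw [e]; ring
  have hC : ∀ b, 0 < b → b ≤ 1 / 2 → (1 + α) ^ (-(1:ℝ)/2) * W ≤ C2Scaled α b := by
    intro b hb hb'
    rw [hWdef, ← integral_const_mul, C2Scaled]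
    refine setIntegral_mono_on (iW.const_mul _)
      (integrableOn_C_kernel (by norm_num) hα hb (by linarith) _)
      measurableSet_Ioo fun t ⟨ht, ht'⟩ => ?_
    have h3 : 0 < 1 - t := by linarith
    have h := affine_pos hb (by linarith) ht.le
    have h' := affine_le_one (b := b) (by linarith) ht'.le
    have h1 : (1 + α) ^ (-(1:ℝ)/2) ≤ (b + (1 - b) * t + α) ^ (-(1:ℝ)/2) :=
      Real.rpow_le_rpow_of_nonpos (by positivity) (by linarith) (by norm_num)
    have h2 : 1 ≤ (b + (1 - b) * t) ^ (-(1:ℝ)/4) :=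
      Real.one_le_rpow_of_pos_of_le_one_of_nonpos h h' (by norm_num)
    calc _ = t ^ (-(1:ℝ)/4) * (1 - t) ^ (-(1:ℝ)/4) * ((1 + α) ^ (-(1:ℝ)/2) * 1) := by ring
      _ ≤ _ := by gcongr
  refine ⟨(1 / 2 : ℝ) ^ ((1:ℝ)/2) * ((1 + α) ^ (-(1:ℝ)/2) * W) / V, by positivity,
    fun b hb hb' => ?_⟩
  rw [C2_neg_eq α (by linarith)]
  have h0 : 0 < 1 - b := by linarith
  have h1 : (1 / 2 : ℝ) ^ ((1:ℝ)/2) ≤ (1 - b) ^ ((1:ℝ)/2) :=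
    Real.rpow_le_rpow (by norm_num) (by linarith) (by norm_num)
  calc _ ≤ (1 / 2 : ℝ) ^ ((1:ℝ)/2) * ((1 + α) ^ (-(1:ℝ)/2) * W) / V * V := by
        gcongr
        exact hA b hb
    _ = (1 / 2 : ℝ) ^ ((1:ℝ)/2) * ((1 + α) ^ (-(1:ℝ)/2) * W) := by field_simp
    _ ≤ _ := by
        gcongr
        exact hC b hb ‹_›

/-- The common singular part of `A₁` and `C₁` as `b → 0`. -/
noncomputable def singularPart (c b : ℝ) : ℝ :=
  ∫ x in Ioo 0 c, x ^ (-(3:ℝ)/4) * (b + x) ^ (-(3:ℝ)/4)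

lemma integrableOn_singularPart {b c : ℝ} (hb : 0 < b) (hc : 0 < c) :
    IntegrableOn (fun x : ℝ => x ^ (-(3:ℝ)/4) * (b + x) ^ (-(3:ℝ)/4)) (Ioo 0 c) := by
  have h := integrableOn_betaWeight_mul (p := -(3:ℝ)/4) (q := 0) (by norm_num) (by norm_num) hc
    (φ := fun x => (b + x) ^ (-(3:ℝ)/4)) fun x hx => ContinuousAt.continuousWithinAt (by
      have h1 : b + x ≠ 0 := by linarith [hx.1]
      fun_prop (disch := exact Or.inl h1))
  simpa only [Real.rpow_zero, mul_one] using h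

lemma le_singularPart {b c : ℝ} (hb : 0 < b) (hbc : b ≤ c) :
    2 ^ (-(3:ℝ)/4) * b ^ (-(1:ℝ)/2) ≤ singularPart c b := by
  have i := integrableOn_singularPart hb (hb.trans_le hbc)
  have hsub : Ioo 0 b ⊆ Ioo 0 c := Ioo_subset_Ioo_right hbc
  have h1 : ∫ x in Ioo 0 b, x ^ (-(3:ℝ)/4) * (b + x) ^ (-(3:ℝ)/4) ≤ singularPart c b := by
    refine setIntegral_mono_set i ?_ hsub.eventuallyLE
    refine (ae_restrict_mem measurableSet_Ioo).mono fun x ⟨hx, _⟩ => ?_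
    simp only [Pi.zero_apply]
    positivity
  refine le_trans ?_ h1
  have h2 : ∫ _ in Ioo 0 b, b ^ (-(3:ℝ)/4) * (2 * b) ^ (-(3:ℝ)/4) ≤
      ∫ x in Ioo 0 b, x ^ (-(3:ℝ)/4) * (b + x) ^ (-(3:ℝ)/4) := by
    refine setIntegral_mono_on (integrableOn_const measure_Ioo_lt_top.ne) (i.mono_set hsub) measurableSet_Ioo fun x ⟨hx, hx'⟩ => ?_
    have := Real.rpow_le_rpow_of_nonpos hx hx'.le (show (-(3:ℝ)/4) ≤ 0 by norm_num)
    have := Real.rpow_le_rpow_of_nonpos (show 0 < b + x by positivity)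
      (show b + x ≤ 2 * b by linarith) (show (-(3:ℝ)/4) ≤ 0 by norm_num)
    gcongr
  refine le_of_eq_of_le ?_ h2
  have e : b ^ (-(1:ℝ)/2) = b * (b ^ (-(3:ℝ)/4) * b ^ (-(3:ℝ)/4)) := by
    nth_rw 2 [← Real.rpow_one b]
    rw [← Real.rpow_add hb, ← Real.rpow_add hb]
    norm_num
  simp only [integral_const, measureReal_restrict_apply_univ, Real.volume_real_Ioo_of_le hb.le,
    smul_eq_mul, sub_zero]
  rw [e, Real.mul_rpow (by norm_num) hb.le]
  ring

lemma singularPart_one_le {α b : ℝ} (hα : 0 < α) (hb : 0 < b) :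
    singularPart 1 b ≤ singularPart α b + α ^ (-(3:ℝ)/4) * α ^ (-(3:ℝ)/4) := by
  have i1 := integrableOn_singularPart hb one_pos
  have iα := integrableOn_singularPart hb hα
  have hpos : ∀ x ∈ Ioo 0 α, 0 ≤ x ^ (-(3:ℝ)/4) * (b + x) ^ (-(3:ℝ)/4) := fun x ⟨hx, _⟩ => by
    positivity
  have hC : 0 < α ^ (-(3:ℝ)/4) * α ^ (-(3:ℝ)/4) := by positivity
  have iα' := (integrable_indicator_iff measurableSet_Ioo).2 iα
  have h : singularPart 1 b ≤ ∫ x in Ioo (0:ℝ) 1, ((Ioo 0 α).indicator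
      (fun x => x ^ (-(3:ℝ)/4) * (b + x) ^ (-(3:ℝ)/4)) x + α ^ (-(3:ℝ)/4) * α ^ (-(3:ℝ)/4)) := by
    refine setIntegral_mono_on i1 (iα'.integrableOn.add (integrableOn_const measure_Ioo_lt_top.ne)) measurableSet_Ioo
      fun x ⟨hx, hx'⟩ => ?_
    by_cases hxα : x < α
    · rw [indicator_of_mem (show x ∈ Ioo 0 α from ⟨hx, hxα⟩)]
      linarith
    · rw [indicator_of_notMem (fun h => hxα h.2), zero_add]
      push Not at hxα
      have := Real.rpow_le_rpow_of_nonpos hα hxα (show (-(3:ℝ)/4) ≤ 0 by norm_num)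
      have := Real.rpow_le_rpow_of_nonpos hα (show α ≤ b + x by linarith)
        (show (-(3:ℝ)/4) ≤ 0 by norm_num)
      gcongr
  refine h.trans ?_
  rw [integral_add iα'.integrableOn (integrableOn_const measure_Ioo_lt_top.ne)]
  refine add_le_add ?_ (by simp)
  rw [singularPart, ← integral_indicator (measurableSet_Ioo (a := (0:ℝ)) (b := α))]
  exact setIntegral_le_integral iα' (ae_of_all _ (indicator_nonneg hpos))

lemma exists_singularPart_le_A1 {α : ℝ} (hα : 0 < α) :
    ∃ N, ∀ b, 0 < b → α ^ ((1:ℝ)/2) * singularPart α b - N ≤ A1 (-α) b := by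
  have iR := integrableOn_betaWeight (p := -(1:ℝ)/2) (q := 0) (by norm_num) (by norm_num) hα
  simp only [Real.rpow_zero, mul_one] at iR
  refine ⟨∫ x in Ioo 0 α, α ^ ((1:ℝ)/2) * (1 / α + 1) * x ^ (-(1:ℝ)/2), fun b hb => ?_⟩
  have iS := integrableOn_singularPart hb hα
  rw [singularPart, ← integral_const_mul, ← integral_sub (iS.const_mul _) (iR.const_mul _),
    A1_neg_eq]
  refine setIntegral_mono_on ((iS.const_mul _).sub (iR.const_mul _))
    (integrableOn_A_kernel (by norm_num) (by norm_num) hα hb) measurableSet_Ioo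
    fun x ⟨hx, hx'⟩ => ?_
  have h0 : 0 < α - x := by linarith
  have hy : x / α ≤ 1 := (div_le_one hα).2 hx'.le
  have hy0 : 0 < x / α := by positivity
  have h1 : α ^ ((1:ℝ)/2) * (1 - x / α) ≤ (α - x) ^ ((1:ℝ)/2) := by
    rw [show α - x = α * (1 - x / α) by field_simp, Real.mul_rpow hα.le (by linarith)]
    gcongr
    exact Real.self_le_rpow_of_le_one (by linarith) (by linarith) (by norm_num)
  have h2 : (1 + x)⁻¹ ≤ (1 + x) ^ (-(3:ℝ)/4) := by
    rw [← Real.rpow_neg_one]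
    exact Real.rpow_le_rpow_of_exponent_le (by linarith) (by norm_num)
  have h3 : 1 - x / α - x ≤ (1 - x / α) * (1 + x)⁻¹ := by
    rw [← div_eq_mul_inv, le_div_iff₀ (by positivity)]
    nlinarith [mul_pos hy0 hx, mul_pos hx hx]
  have h4 : α ^ ((1:ℝ)/2) * (1 - x / α - x) ≤ (α - x) ^ ((1:ℝ)/2) * (1 + x) ^ (-(3:ℝ)/4) :=
    calc _ ≤ α ^ ((1:ℝ)/2) * ((1 - x / α) * (1 + x)⁻¹) := by gcongr
      _ = α ^ ((1:ℝ)/2) * (1 - x / α) * (1 + x)⁻¹ := by ring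
      _ ≤ _ := mul_le_mul h1 h2 (by positivity) (by positivity)
  have h5 : x * (x ^ (-(3:ℝ)/4) * (b + x) ^ (-(3:ℝ)/4)) ≤ x ^ (-(1:ℝ)/2) := by
    have e : x ^ (-(1:ℝ)/2) = x * (x ^ (-(3:ℝ)/4) * x ^ (-(3:ℝ)/4)) := by
      nth_rw 2 [← Real.rpow_one x]
      rw [← Real.rpow_add hx, ← Real.rpow_add hx]
      norm_num
    have := Real.rpow_le_rpow_of_nonpos hx (show x ≤ b + x by linarith)
      (show (-(3:ℝ)/4) ≤ 0 by norm_num)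
    rw [e]
    gcongr
  have h6 : 0 ≤ x ^ (-(3:ℝ)/4) * (b + x) ^ (-(3:ℝ)/4) := by positivity
  have h7 : 0 ≤ α ^ ((1:ℝ)/2) * (1 / α + 1) := by positivity
  calc _ ≤ α ^ ((1:ℝ)/2) * (x ^ (-(3:ℝ)/4) * (b + x) ^ (-(3:ℝ)/4)) -
        α ^ ((1:ℝ)/2) * (1 / α + 1) * (x * (x ^ (-(3:ℝ)/4) * (b + x) ^ (-(3:ℝ)/4))) := by gcongr
    _ = α ^ ((1:ℝ)/2) * (1 - x / α - x) * (x ^ (-(3:ℝ)/4) * (b + x) ^ (-(3:ℝ)/4)) := by ring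
    _ ≤ (α - x) ^ ((1:ℝ)/2) * (1 + x) ^ (-(3:ℝ)/4) *
        (x ^ (-(3:ℝ)/4) * (b + x) ^ (-(3:ℝ)/4)) := mul_le_mul_of_nonneg_right h4 h6
    _ = _ := by ring

lemma exists_C1_le_singularPart {α : ℝ} (hα : 0 < α) :
    ∃ N, ∀ b, 0 < b → b < 1 →
      C1 (-α) b ≤ (1 - b) ^ (-(5:ℝ)/4) * (α ^ ((1:ℝ)/2) * singularPart α b + N) := by
  have iW := integrableOn_betaWeight (p := -(3:ℝ)/4) (q := -(3:ℝ)/4)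
    (by norm_num) (by norm_num) one_pos
  set M := α ^ ((1:ℝ)/2) * (1 / α + 1) with hM
  have hM0 : 0 < M := by positivity
  refine ⟨α ^ ((1:ℝ)/2) * (α ^ (-(3:ℝ)/4) * α ^ (-(3:ℝ)/4)) +
    ∫ x in Ioo 0 1, 2 * M * (x ^ (-(3:ℝ)/4) * (1 - x) ^ (-(3:ℝ)/4)), fun b hb hb' => ?_⟩
  have hb1 : 0 < 1 - b := by linarith
  have iS := integrableOn_singularPart hb one_pos
  have key : C1Scaled α b ≤ (1 - b) ^ (-(3:ℝ)/4) * (α ^ ((1:ℝ)/2) * singularPart 1 b +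
      ∫ x in Ioo 0 1, 2 * M * (x ^ (-(3:ℝ)/4) * (1 - x) ^ (-(3:ℝ)/4))) := by
    rw [singularPart, ← integral_const_mul (α ^ ((1:ℝ)/2)),
      ← integral_add (iS.const_mul _) (iW.const_mul _), ← integral_const_mul]
    refine setIntegral_mono_on (integrableOn_C_kernel (by norm_num) hα hb hb'.le _)
      (((iS.const_mul _).add (iW.const_mul _)).const_mul _) measurableSet_Ioo
      fun t ⟨ht, ht'⟩ => ?_
    have h0 : 0 < 1 - t := by linarith
    have hbt : 0 < b + t := by positivity
    have h1 : (b + (1 - b) * t) ^ (-(3:ℝ)/4) ≤ (1 - b) ^ (-(3:ℝ)/4) * (b + t) ^ (-(3:ℝ)/4) := by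
      rw [← Real.mul_rpow hb1.le hbt.le]
      exact Real.rpow_le_rpow_of_nonpos (by positivity) (by nlinarith) (by norm_num)
    have h2 : (b + (1 - b) * t + α) ^ ((1:ℝ)/2) ≤ α ^ ((1:ℝ)/2) * (1 + (b + t) / α) := by
      calc _ ≤ (α * (1 + (b + t) / α)) ^ ((1:ℝ)/2) := by
            have := affine_pos hb hb'.le ht.le
            refine Real.rpow_le_rpow (by positivity) ?_ (by norm_num)
            have : α * (1 + (b + t) / α) = α + (b + t) := by field_simp
            nlinarith
        _ = α ^ ((1:ℝ)/2) * (1 + (b + t) / α) ^ ((1:ℝ)/2) := Real.mul_rpow hα.le (by positivity)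
        _ ≤ _ := by
            gcongr
            refine Real.rpow_le_self_of_one_le ?_ (by norm_num)
            have : 0 < (b + t) / α := by positivity
            linarith
    set w := (1 - t) ^ (-(3:ℝ)/4) with hw
    have hw0 : 0 < w := by positivity
    have h3 : w ≤ 1 + t * w := by
      have : (1 - t) * w ≤ 1 := by
        rw [hw]
        nth_rw 1 [← Real.rpow_one (1 - t)]
        rw [← Real.rpow_add h0]
        exact Real.rpow_le_one h0.le (by linarith) (by norm_num)
      linarith
    have h4 : w * (b + (1 - b) * t + α) ^ ((1:ℝ)/2) ≤
        α ^ ((1:ℝ)/2) + M * ((b + t) * w) := by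
      calc _ ≤ w * (α ^ ((1:ℝ)/2) * (1 + (b + t) / α)) := by gcongr
        _ = α ^ ((1:ℝ)/2) * w + α ^ ((1:ℝ)/2) * ((b + t) * w / α) := by ring
        _ ≤ α ^ ((1:ℝ)/2) * (1 + (b + t) * w) + α ^ ((1:ℝ)/2) * ((b + t) * w / α) := by
            have : t * w ≤ (b + t) * w := by gcongr; linarith
            gcongr
            linarith
        _ = _ := by rw [hM]; ring
    have h5 : (b + t) ^ (-(3:ℝ)/4) * (b + t) ≤ 2 := by
      nth_rw 2 [← Real.rpow_one (b + t)]
      rw [← Real.rpow_add hbt]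
      calc _ ≤ (2:ℝ) ^ (-(3:ℝ)/4 + 1) :=
            Real.rpow_le_rpow hbt.le (by linarith) (by norm_num)
        _ ≤ 2 ^ (1:ℝ) := Real.rpow_le_rpow_of_exponent_le (by norm_num) (by norm_num)
        _ = 2 := Real.rpow_one 2
    have hs := affine_pos hb hb'.le ht.le
    calc _ = t ^ (-(3:ℝ)/4) * (w * (b + (1 - b) * t + α) ^ ((1:ℝ)/2) *
          (b + (1 - b) * t) ^ (-(3:ℝ)/4)) := by ring
      _ ≤ t ^ (-(3:ℝ)/4) * ((α ^ ((1:ℝ)/2) + M * ((b + t) * w)) *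
          ((1 - b) ^ (-(3:ℝ)/4) * (b + t) ^ (-(3:ℝ)/4))) := by gcongr
      _ = (1 - b) ^ (-(3:ℝ)/4) * (α ^ ((1:ℝ)/2) * (t ^ (-(3:ℝ)/4) * (b + t) ^ (-(3:ℝ)/4)) +
          ((b + t) ^ (-(3:ℝ)/4) * (b + t)) * M * (t ^ (-(3:ℝ)/4) * w)) := by ring
      _ ≤ _ := by gcongr
  have e : (1 - b) ^ (-(5:ℝ)/4) = (1 - b) ^ (-(1:ℝ)/2) * (1 - b) ^ (-(3:ℝ)/4) := by
    rw [← Real.rpow_add hb1]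
    norm_num
  rw [C1_neg_eq α hb', e, mul_assoc]
  refine mul_le_mul_of_nonneg_left (key.trans ?_) (by positivity)
  refine mul_le_mul_of_nonneg_left ?_ (by positivity)
  have := mul_le_mul_of_nonneg_left (singularPart_one_le hα hb)
    (show 0 ≤ α ^ ((1:ℝ)/2) by positivity)
  linarith

lemma tendsto_singularPart_atTop {α : ℝ} (hα : 0 < α) :
    Filter.Tendsto (singularPart α) (nhdsWithin 0 (Ioi 0)) Filter.atTop := by
  have h : Filter.Tendsto (fun b : ℝ => 2 ^ (-(3:ℝ)/4) * b ^ (-(1:ℝ)/2))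
      (nhdsWithin 0 (Ioi 0)) Filter.atTop :=
    (tendsto_rpow_neg_nhdsGT_zero (by norm_num)).const_mul_atTop (by positivity)
  refine Filter.tendsto_atTop_mono' _ ?_ h
  filter_upwards [Ioo_mem_nhdsGT hα] with b hb using le_singularPart hb.1 hb.2.le

/-- Near `b = 0` the first period quotient is smaller than the second one. -/
lemma exists_period_lt {α : ℝ} (hα : 0 < α) :
    ∃ b, 0 < b ∧ b < 1 ∧
      (B1 (-α) b + C1 (-α) b) * A2 (-α) b < (B2 (-α) b + C2 (-α) b) * A1 (-α) b := by
  obtain ⟨c, hc, hC2⟩ := exists_mul_A2_le_C2 hα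
  obtain ⟨N₁, hA1⟩ := exists_singularPart_le_A1 hα
  obtain ⟨N₂, hC1⟩ := exists_C1_le_singularPart hα
  obtain ⟨N₃, hB1⟩ := isCompact_Icc.exists_bound_of_continuousOn (continuousOn_B1 hα)
  have hs : 0 < α ^ ((1:ℝ)/2) := by positivity
  have hr : ∀ᶠ b : ℝ in nhdsWithin 0 (Ioi 0), (1 - b) ^ (-(5:ℝ)/4) < 1 + c / 2 := by
    have hcont : ContinuousAt (fun b : ℝ => (1 - b) ^ (-(5:ℝ)/4)) 0 :=
      ContinuousAt.rpow (by fun_prop) (by fun_prop) (Or.inl (by norm_num))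
    refine (hcont.tendsto.mono_left nhdsWithin_le_nhds).eventually_lt_const ?_
    simp only [sub_zero, Real.one_rpow]
    linarith
  have hK := ((tendsto_singularPart_atTop hα).const_mul_atTop
    (show 0 < c / 2 * α ^ ((1:ℝ)/2) by positivity)).eventually_gt_atTop
    (N₃ + (1 + c / 2) * |N₂| + (1 + c) * N₁)
  obtain ⟨b, hr, hK, hb, hb'⟩ :=
    (hr.and (hK.and (Ioo_mem_nhdsGT (show (0:ℝ) < 1 / 2 by norm_num)))).exists
  refine ⟨b, hb, by linarith, ?_⟩
  have hK0 : 0 ≤ singularPart α b :=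
    setIntegral_nonneg measurableSet_Ioo fun x ⟨hx, _⟩ => by positivity
  have h1 : B1 (-α) b ≤ N₃ := (le_abs_self _).trans (hB1 b ⟨hb.le, by linarith⟩)
  have h2 : C1 (-α) b ≤ (1 + c / 2) * (α ^ ((1:ℝ)/2) * singularPart α b + |N₂|) := by
    have : (0:ℝ) < 1 - b := by linarith
    refine (hC1 b hb (by linarith)).trans ?_
    calc _ ≤ (1 - b) ^ (-(5:ℝ)/4) * (α ^ ((1:ℝ)/2) * singularPart α b + |N₂|) := by
          gcongr
          exact le_abs_self _
      _ ≤ _ := by gcongr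
  have h3 := mul_le_mul_of_nonneg_left (hA1 b hb) (show 0 ≤ 1 + c by positivity)
  have h4 : B1 (-α) b + C1 (-α) b < (1 + c) * A1 (-α) b := by linarith
  have hA1p := A1_pos hα hb
  have hA2p := A2_pos hα hb
  calc _ < (1 + c) * A1 (-α) b * A2 (-α) b := by gcongr
    _ = (A2 (-α) b + c * A2 (-α) b) * A1 (-α) b := by ring
    _ ≤ _ := by
        gcongr
        · exact A2_le_B2 hα hb
        · exact hC2 b hb hb'.le

theorem cs4_period_problem :
    ∀ a : ℝ, a < 0 → ∃ b : ℝ, 0 < b ∧ b < 1 ∧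
      (B1 a b + C1 a b) / A1 a b = (B2 a b + C2 a b) / A2 a b := by
  intro a ha
  obtain ⟨α, rfl⟩ : ∃ α, a = -α := ⟨-a, (neg_neg a).symm⟩
  have hα : 0 < α := by linarith
  obtain ⟨l, hl, hl', hlt⟩ := exists_period_lt hα
  have scale : ∀ {b : ℝ}, b < 1 → (1 - b) ^ ((1:ℝ)/2) * C1 (-α) b = C1Scaled α b := by
    intro b hb
    rw [C1_neg_eq α hb, ← mul_assoc, ← Real.rpow_add (by linarith)]
    norm_num
  let G : ℝ → ℝ := fun b => ((1 - b) ^ ((1:ℝ)/2) * B1 (-α) b + C1Scaled α b) * A2 (-α) b -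
    (1 - b) ^ ((1:ℝ)/2) * (B2 (-α) b + (1 - b) ^ ((1:ℝ)/2) * C2Scaled α b) * A1 (-α) b
  have hG : ∀ {b : ℝ}, b < 1 → G b = (1 - b) ^ ((1:ℝ)/2) *
      ((B1 (-α) b + C1 (-α) b) * A2 (-α) b - (B2 (-α) b + C2 (-α) b) * A1 (-α) b) := by
    intro b hb
    simp only [G]
    rw [← scale hb, ← C2_neg_eq α hb]
    ring
  have hsub : Icc l 1 ⊆ Icc 0 1 := Icc_subset_Icc_left hl.le
  have hpow : ContinuousOn (fun b : ℝ => (1 - b) ^ ((1:ℝ)/2)) (Icc l 1) :=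
    (Continuous.rpow_const (by fun_prop) fun _ => Or.inr (by norm_num)).continuousOn
  have hcont : ContinuousOn G (Icc l 1) :=
    (((hpow.mul ((continuousOn_B1 hα).mono hsub)).add (continuousOn_C1Scaled hα hl)).mul
      (continuousOn_A2 hα hl)).sub ((hpow.mul (((continuousOn_B2 hα).mono hsub).add
      (hpow.mul (continuousOn_C2Scaled hα hl)))).mul (continuousOn_A1 hα hl))
  have hGl : G l < 0 := by
    rw [hG hl']
    exact mul_neg_of_pos_of_neg (Real.rpow_pos_of_pos (by linarith) _) (by linarith)
  have hG1 : 0 < G 1 := by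
    have h : G 1 = C1Scaled α 1 * A2 (-α) 1 := by simp [G]
    rw [h]
    exact mul_pos (C1Scaled_pos hα one_pos le_rfl) (A2_pos hα one_pos)
  obtain ⟨b, ⟨hlb, hb⟩, hb0⟩ := intermediate_value_Ioo hl'.le hcont ⟨hGl, hG1⟩
  refine ⟨b, hl.trans hlb, hb, ?_⟩
  rw [hG hb, mul_eq_zero_iff_left (Real.rpow_pos_of_pos (by linarith) _).ne'] at hb0
  rw [div_eq_div_iff (A1_pos hα (hl.trans hlb)).ne' (A2_pos hα (hl.trans hlb)).ne']
  linarith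
end

section
/- For each fixed real a < 0 there exist constants C > 0 and δ ∈ (0,1) such that for all b ∈ (1-δ,1): (1/C)·(1-b)^{-1/2} ≤ C₁(a,b) ≤ C·(1-b)^{-1/2} and (1/C)·(1-b)^{1/2} ≤ C₂(a,b) ≤ C·(1-b)^{1/2}. (Asymptotic orders of C₁ and C₂ as b → 1⁻.) -/
open MeasureTheory Set

lemma intervalIntegrable_sub_rpow_mul_sub_rpow {p b c : ℝ} (hp : -1 < p) (hbc : b < c) :
    IntervalIntegrable (fun z : ℝ => (z - b) ^ p * (c - z) ^ p) volume b c := by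
  have left : IntervalIntegrable (fun z : ℝ => (z - b) ^ p) volume b ((b + c) / 2) := by
    have h := (intervalIntegral.intervalIntegrable_rpow' (a := 0) (b := (c - b) / 2)
      hp).comp_sub_right b
    rwa [zero_add, show (c - b) / 2 + b = (b + c) / 2 by ring] at h
  have right : IntervalIntegrable (fun z : ℝ => (c - z) ^ p) volume ((b + c) / 2) c := by
    have h := (intervalIntegral.intervalIntegrable_rpow' (a := (c - b) / 2) (b := 0)
      hp).comp_sub_left c
    rwa [sub_zero, show c - (c - b) / 2 = (b + c) / 2 by ring] at h
  refine (left.mul_continuousOn ?_).trans (right.continuousOn_mul ?_)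
  · intro z hz
    rw [uIcc_of_le (by linarith)] at hz
    exact (ContinuousAt.rpow_const (by fun_prop)
      (Or.inl (by have := hz.2; intro; linarith))).continuousWithinAt
  · intro z hz
    rw [uIcc_of_le (by linarith)] at hz
    exact (ContinuousAt.rpow_const (by fun_prop)
      (Or.inl (by have := hz.1; intro; linarith))).continuousWithinAt

lemma integral_sub_rpow_mul_sub_rpow (p : ℝ) {b c : ℝ} (hbc : b < c) :
    ∫ z in b..c, (z - b) ^ p * (c - z) ^ p =
      (c - b) ^ (2 * p + 1) * ∫ t in (0 : ℝ)..1, t ^ p * (1 - t) ^ p := by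
  have hd : 0 < c - b := sub_pos.2 hbc
  have scale : ∀ z ∈ uIcc b c, (z - b) ^ p * (c - z) ^ p = (c - b) ^ (2 * p) *
      ((z / (c - b) - b / (c - b)) ^ p * (1 - (z / (c - b) - b / (c - b))) ^ p) := by
    intro z hz
    rw [uIcc_of_le hbc.le] at hz
    have h₁ : z / (c - b) - b / (c - b) = (z - b) / (c - b) := by ring
    have h₂ : 1 - (z - b) / (c - b) = (c - z) / (c - b) := by field_simp; ring
    have hpow : (c - b) ^ p ≠ 0 := (Real.rpow_pos_of_pos hd p).ne'
    rw [h₁, h₂, Real.div_rpow (sub_nonneg.2 hz.1) hd.le, Real.div_rpow (sub_nonneg.2 hz.2) hd.le,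
      two_mul, Real.rpow_add hd]
    field_simp
  rw [intervalIntegral.integral_congr scale, intervalIntegral.integral_const_mul,
    intervalIntegral.integral_comp_div_sub (fun t : ℝ => t ^ p * (1 - t) ^ p) hd.ne',
    Real.rpow_add_one hd.ne', smul_eq_mul, ← sub_div, ← sub_div, sub_self, zero_div,
    div_self hd.ne', mul_assoc]

/-- An integral over `(b, 1)` with equal power singularities at both endpoints and a continuous
positive weight has order `(1 - b) ^ (2 * p + 1)`, uniformly for `b` near `1`. -/
lemma exists_bounds_integral_weight_mul_rpow {p b₀ : ℝ} (hp : -1 < p) (hb₀ : b₀ < 1) {w : ℝ → ℝ}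
    (hw : ContinuousOn w (Icc b₀ 1)) (hpos : ∀ z ∈ Icc b₀ 1, 0 < w z) :
    ∃ m M : ℝ, 0 < m ∧ 0 < M ∧ ∀ b ∈ Ioo b₀ 1,
      m * (1 - b) ^ (2 * p + 1) ≤ ∫ z in Ioo b 1, w z * ((z - b) ^ p * (1 - z) ^ p) ∧
      ∫ z in Ioo b 1, w z * ((z - b) ^ p * (1 - z) ^ p) ≤ M * (1 - b) ^ (2 * p + 1) := by
  have hne : (Icc b₀ 1).Nonempty := nonempty_Icc.2 hb₀.le
  obtain ⟨x, hx, hmin⟩ := isCompact_Icc.exists_isMinOn hne hw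
  obtain ⟨y, hy, hmax⟩ := isCompact_Icc.exists_isMaxOn hne hw
  set I : ℝ := ∫ t in (0 : ℝ)..1, t ^ p * (1 - t) ^ p
  have hIpos : 0 < I := by
    refine intervalIntegral.intervalIntegral_pos_of_pos_on ?_ (fun t ht => ?_) one_pos
    · simpa using intervalIntegrable_sub_rpow_mul_sub_rpow hp one_pos
    · exact mul_pos (Real.rpow_pos_of_pos ht.1 p) (Real.rpow_pos_of_pos (sub_pos.2 ht.2) p)
  refine ⟨w x * I, w y * I, mul_pos (hpos x hx) hIpos, mul_pos (hpos y hy) hIpos, fun b hb => ?_⟩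
  have hint := intervalIntegrable_sub_rpow_mul_sub_rpow hp hb.2
  have hsub : Icc b 1 ⊆ Icc b₀ 1 := Icc_subset_Icc_left hb.1.le
  have hwint : IntervalIntegrable (fun z => w z * ((z - b) ^ p * (1 - z) ^ p)) volume b 1 :=
    hint.continuousOn_mul (by rw [uIcc_of_le hb.2.le]; exact hw.mono hsub)
  have hnonneg : ∀ z ∈ Icc b 1, 0 ≤ (z - b) ^ p * (1 - z) ^ p := fun z hz =>
    mul_nonneg (Real.rpow_nonneg (sub_nonneg.2 hz.1) p) (Real.rpow_nonneg (sub_nonneg.2 hz.2) p)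
  have hconst (k : ℝ) : k * I * (1 - b) ^ (2 * p + 1) =
      ∫ z in b..1, k * ((z - b) ^ p * (1 - z) ^ p) := by
    rw [intervalIntegral.integral_const_mul, integral_sub_rpow_mul_sub_rpow p hb.2]
    ring
  rw [← integral_Ioc_eq_integral_Ioo, ← intervalIntegral.integral_of_le hb.2.le, hconst, hconst]
  exact ⟨intervalIntegral.integral_mono_on hb.2.le (hint.const_mul _) hwint fun z hz =>
      mul_le_mul_of_nonneg_right (hmin (hsub hz)) (hnonneg z hz),
    intervalIntegral.integral_mono_on hb.2.le hwint (hint.const_mul _) fun z hz =>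
      mul_le_mul_of_nonneg_right (hmax (hsub hz)) (hnonneg z hz)⟩

lemma exists_bounds_integral_rpow_near_one {a p : ℝ} (ha : a < 0) (r : ℝ) (hp : -1 < p) :
    ∃ m M : ℝ, 0 < m ∧ 0 < M ∧ ∀ b ∈ Ioo (1 - 1 / 2 : ℝ) 1,
      m * (1 - b) ^ (2 * p + 1) ≤
        ∫ z in Ioo b 1, (z - a) ^ r * z ^ p * (z - b) ^ p * (1 - z) ^ p ∧
      ∫ z in Ioo b 1, (z - a) ^ r * z ^ p * (z - b) ^ p * (1 - z) ^ p ≤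
        M * (1 - b) ^ (2 * p + 1) := by
  have hbase : ∀ z ∈ Icc (1 - 1 / 2 : ℝ) 1, 0 < z - a ∧ 0 < z := fun z hz => by
    have := hz.1
    constructor <;> linarith
  have hcont : ContinuousOn (fun z : ℝ => (z - a) ^ r * z ^ p) (Icc (1 - 1 / 2) 1) :=
    ((continuousOn_id.sub continuousOn_const).rpow_const fun z hz => Or.inl (hbase z hz).1.ne').mul
      (continuousOn_id.rpow_const fun z hz => Or.inl (hbase z hz).2.ne')
  have h := exists_bounds_integral_weight_mul_rpow hp (by norm_num) hcont fun z hz =>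
    mul_pos (Real.rpow_pos_of_pos (hbase z hz).1 r) (Real.rpow_pos_of_pos (hbase z hz).2 p)
  simpa only [← mul_assoc] using h

theorem cs4_C_asymptotics_near_one :
    ∀ a : ℝ, a < 0 → ∃ C δ : ℝ, 0 < C ∧ δ ∈ Ioo (0:ℝ) 1 ∧
      ∀ b ∈ Ioo (1 - δ) 1,
        ((1 / C) * (1 - b) ^ (-(1:ℝ)/2) ≤ C1 a b ∧ C1 a b ≤ C * (1 - b) ^ (-(1:ℝ)/2)) ∧
        ((1 / C) * (1 - b) ^ ((1:ℝ)/2) ≤ C2 a b ∧ C2 a b ≤ C * (1 - b) ^ ((1:ℝ)/2)) := by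
  intro a ha
  obtain ⟨m₁, M₁, hm₁, hM₁, h₁⟩ :=
    exists_bounds_integral_rpow_near_one ha (1 / 2) (p := -3 / 4) (by norm_num)
  obtain ⟨m₂, M₂, hm₂, hM₂, h₂⟩ :=
    exists_bounds_integral_rpow_near_one ha (-1 / 2) (p := -1 / 4) (by norm_num)
  rw [show 2 * (-3 / 4 : ℝ) + 1 = -1 / 2 by norm_num] at h₁
  rw [show 2 * (-1 / 4 : ℝ) + 1 = 1 / 2 by norm_num] at h₂
  have hm₁' := inv_pos.2 hm₁
  have hm₂' := inv_pos.2 hm₂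
  have hC : 0 < m₁⁻¹ + M₁ + m₂⁻¹ + M₂ := by positivity
  refine ⟨m₁⁻¹ + M₁ + m₂⁻¹ + M₂, 1 / 2, hC, by norm_num, fun b hb => ?_⟩
  have hCm₁ : 1 / (m₁⁻¹ + M₁ + m₂⁻¹ + M₂) ≤ m₁ := by
    rw [one_div]; exact inv_le_of_inv_le₀ hm₁ (by linarith)
  have hCm₂ : 1 / (m₁⁻¹ + M₁ + m₂⁻¹ + M₂) ≤ m₂ := by
    rw [one_div]; exact inv_le_of_inv_le₀ hm₂ (by linarith)
  have hr (r : ℝ) : 0 ≤ (1 - b) ^ r := Real.rpow_nonneg (sub_nonneg.2 hb.2.le) r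
  exact ⟨⟨(mul_le_mul_of_nonneg_right hCm₁ (hr _)).trans (h₁ b hb).1,
      (h₁ b hb).2.trans (mul_le_mul_of_nonneg_right (by linarith) (hr _))⟩,
    ⟨(mul_le_mul_of_nonneg_right hCm₂ (hr _)).trans (h₂ b hb).1,
      (h₂ b hb).2.trans (mul_le_mul_of_nonneg_right (by linarith) (hr _))⟩⟩
end
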